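/- arXiv:1710.09546 — 2 statements merged into one kernel-verified Lean document; each statement's English description precedes it below -/
import Mathlib

section
/- Suppose that under the flow one has ω(t) = 0, L(t) ≤ L₀, and ‖k_s(·,t)‖₂² L(t)³ ≤ ((√1717 − 37)/174) π³ − δ₀ for all t ∈ [0,T), for some δ₀ > 0 and L₀ = L(0). Then there exists δ > 0, depending only on δ₀ and L₀, such that (d/dt) ‖k_{ss}(·,t)‖₂² ≤ − δ ‖k_{ss}(·,t)‖₂² for all t, and consequently ‖k_{ss}(·,t)‖₂² ≤ ‖k_{ss}(·,0)‖₂² e^{−δ t} for all t ∈ [0,T). -/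
noncomputable section

open Real Set MeasureTheory intervalIntegral
open scoped ENNReal RealInnerProductSpace

/-- The Euclidean plane. -/
abbrev E2 : Type := EuclideanSpace ℝ (Fin 2)

/-- Counterclockwise rotation by `π/2`. -/
def rot (v : E2) : E2 := (WithLp.equiv 2 (Fin 2 → ℝ)).symm ![-(v 1), v 0]

/-- Arc length derivative `∂ₛ = |∂ₓγ|⁻¹ ∂ₓ` of a scalar function along the curve `γ`. -/
def aderiv (γ : ℝ → E2) (f : ℝ → ℝ) (x : ℝ) : ℝ := (‖deriv γ x‖)⁻¹ * deriv f x

/-- Iterated arc length derivative. -/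
def aderivIter (γ : ℝ → E2) : ℕ → (ℝ → ℝ) → (ℝ → ℝ)
  | 0, f => f
  | n + 1, f => aderiv γ (aderivIter γ n f)

/-- Arc length derivative of a vector-valued function along `γ`. -/
def aderivVec (γ : ℝ → E2) (f : ℝ → E2) (x : ℝ) : E2 := (‖deriv γ x‖)⁻¹ • deriv f x

/-- Unit tangent vector `τ = ∂ₛ γ`. -/
def utangent (γ : ℝ → E2) (x : ℝ) : E2 := aderivVec γ γ x

/-- Unit normal `ν`, the counterclockwise rotation of `τ` by `π/2`. -/
def unormal (γ : ℝ → E2) (x : ℝ) : E2 := rot (utangent γ x)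

/-- Scalar curvature `k = ⟨∂ₛτ, ν⟩`. -/
def curv (γ : ℝ → E2) (x : ℝ) : ℝ := ⟪aderivVec γ (utangent γ) x, unormal γ x⟫

/-- `j`-th arc length derivative of the curvature, `k_{s^j}`. -/
def kds (γ : ℝ → E2) (j : ℕ) : ℝ → ℝ := aderivIter γ j (curv γ)

/-- The normal speed `F = k_{s⁴} + k² k_{ss} - (1/2) k k_s²`. -/
def speedF (γ : ℝ → E2) (x : ℝ) : ℝ :=
  kds γ 4 x + (curv γ x) ^ 2 * kds γ 2 x - (1 / 2) * curv γ x * (kds γ 1 x) ^ 2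

/-- `∫_γ f ds`, the integral of `f` along `γ : [-1,1] → ℝ²` with respect to arc length. -/
def cint (γ : ℝ → E2) (f : ℝ → ℝ) : ℝ := ∫ x in (-1:ℝ)..1, f x * ‖deriv γ x‖

/-- The length of `γ`. -/
def clen (γ : ℝ → E2) : ℝ := cint γ (fun _ => 1)

/-- `‖k_{s^j}‖₂² = ∫_γ k_{s^j}² ds`. -/
def knorm2 (γ : ℝ → E2) (j : ℕ) : ℝ := cint γ (fun x => (kds γ j x) ^ 2)

/-- Total curvature `∫_γ k ds`. -/
def totalK (γ : ℝ → E2) : ℝ := cint γ (curv γ)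

/-- The time interval `[0, T)`, `T ∈ (0, ∞]`. -/
def inTime (T : ℝ≥0∞) (t : ℝ) : Prop := 0 ≤ t ∧ ENNReal.ofReal t < T

/-- A smooth family of regular plane curves `γ : [-1,1] × [0,T) → ℝ²` moving with
normal speed `F = k_{s⁴} + k² k_{ss} - (1/2) k k_s²`, i.e. `∂ₜγ = F ν`. -/
structure SixthFlow (T : ℝ≥0∞) where
  Tpos : 0 < T
  γ : ℝ → ℝ → E2
  smooth : ContDiff ℝ (⊤ : ℕ∞) (Function.uncurry γ)
  regular : ∀ ⦃t x : ℝ⦄, inTime T t → x ∈ Icc (-1:ℝ) 1 → deriv (γ t) x ≠ 0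
  flow : ∀ ⦃t x : ℝ⦄, inTime T t → x ∈ Icc (-1:ℝ) 1 →
    HasDerivWithinAt (fun u => γ u x) (speedF (γ t) x • unormal (γ t) x) (Ici 0) t

/-- The boundary conditions: the endpoints of the curve lie on two fixed parallel vertical
lines at distance `|e| > 0` (at abscissae `lineMinus` and `linePlus`), the curve meets these
lines perpendicularly (Neumann condition: the unit normal of the curve is orthogonal to the
unit normal `(1,0)` of the lines), and `k_s = k_{sss} = 0` at both endpoints. -/
structure BC {T : ℝ≥0∞} (Φ : SixthFlow T) (e : ℝ) where
  he : e ≠ 0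
  lineMinus : ℝ
  linePlus : ℝ
  hdist : |linePlus - lineMinus| = |e|
  onLeft : ∀ ⦃t : ℝ⦄, inTime T t → Φ.γ t (-1) 0 = lineMinus
  onRight : ∀ ⦃t : ℝ⦄, inTime T t → Φ.γ t 1 0 = linePlus
  neumann : ∀ ⦃t : ℝ⦄, inTime T t →
    unormal (Φ.γ t) (-1) 0 = 0 ∧ unormal (Φ.γ t) 1 0 = 0
  noflux : ∀ ⦃t : ℝ⦄, inTime T t →
    kds (Φ.γ t) 1 (-1) = 0 ∧ kds (Φ.γ t) 1 1 = 0
  noflux3 : ∀ ⦃t : ℝ⦄, inTime T t →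
    kds (Φ.γ t) 3 (-1) = 0 ∧ kds (Φ.γ t) 3 1 = 0

section TwoParameter

variable {E : Type*} [NormedAddCommGroup E] [NormedSpace ℝ E] {U : Set (ℝ × ℝ)}

/-- `f` is smooth on `U ⊆ ℝ × ℝ` as a function of its two arguments. -/
def SmoothOn (U : Set (ℝ × ℝ)) (f : ℝ → ℝ → E) : Prop :=
  ContDiffOn ℝ (⊤ : ℕ∞) (Function.uncurry f) U

/-- Derivative in the first (time) argument. -/
def dtime (f : ℝ → ℝ → E) (t x : ℝ) : E := deriv (fun u => f u x) t

/-- Derivative in the second (space) argument. -/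
def dspace (f : ℝ → ℝ → E) (t x : ℝ) : E := deriv (f t) x

lemma SmoothOn.hasFDerivAt {f : ℝ → ℝ → E} (hf : SmoothOn U f) (hU : IsOpen U) {p : ℝ × ℝ}
    (hp : p ∈ U) : HasFDerivAt (Function.uncurry f) (fderiv ℝ (Function.uncurry f) p) p :=
  ((hf.contDiffAt (hU.mem_nhds hp)).differentiableAt (by simp)).hasFDerivAt

lemma SmoothOn.hasDerivAt_space_fderiv {f : ℝ → ℝ → E} (hf : SmoothOn U f) (hU : IsOpen U)
    {t x : ℝ} (hp : (t, x) ∈ U) :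
    HasDerivAt (f t) (fderiv ℝ (Function.uncurry f) (t, x) (0, 1)) x :=
  HasFDerivAt.comp_hasDerivAt (f := fun y => (t, y)) x (hf.hasFDerivAt hU hp)
    ((hasDerivAt_const x t).prodMk (hasDerivAt_id x))

lemma SmoothOn.hasDerivAt_time_fderiv {f : ℝ → ℝ → E} (hf : SmoothOn U f) (hU : IsOpen U)
    {t x : ℝ} (hp : (t, x) ∈ U) :
    HasDerivAt (fun u => f u x) (fderiv ℝ (Function.uncurry f) (t, x) (1, 0)) t :=
  HasFDerivAt.comp_hasDerivAt (f := fun u => (u, x)) t (hf.hasFDerivAt hU hp)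
    ((hasDerivAt_id t).prodMk (hasDerivAt_const t x))

lemma SmoothOn.hasDerivAt_space {f : ℝ → ℝ → E} (hf : SmoothOn U f) (hU : IsOpen U)
    {t x : ℝ} (hp : (t, x) ∈ U) : HasDerivAt (f t) (dspace f t x) x :=
  (hf.hasDerivAt_space_fderiv hU hp).differentiableAt.hasDerivAt

lemma SmoothOn.hasDerivAt_time {f : ℝ → ℝ → E} (hf : SmoothOn U f) (hU : IsOpen U)
    {t x : ℝ} (hp : (t, x) ∈ U) : HasDerivAt (fun u => f u x) (dtime f t x) t :=
  (hf.hasDerivAt_time_fderiv hU hp).differentiableAt.hasDerivAt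

lemma SmoothOn.fderiv_apply {f : ℝ → ℝ → E} (hf : SmoothOn U f) (hU : IsOpen U) (v : ℝ × ℝ) :
    ContDiffOn ℝ (⊤ : ℕ∞) (fun p => fderiv ℝ (Function.uncurry f) p v) U :=
  (hf.fderiv_of_isOpen hU (by simp)).clm_apply contDiffOn_const

lemma SmoothOn.dspace {f : ℝ → ℝ → E} (hf : SmoothOn U f) (hU : IsOpen U) :
    SmoothOn U (dspace f) :=
  (hf.fderiv_apply hU (0, 1)).congr fun _ hp => (hf.hasDerivAt_space_fderiv hU hp).deriv

lemma SmoothOn.dtime {f : ℝ → ℝ → E} (hf : SmoothOn U f) (hU : IsOpen U) :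
    SmoothOn U (dtime f) :=
  (hf.fderiv_apply hU (1, 0)).congr fun _ hp => (hf.hasDerivAt_time_fderiv hU hp).deriv

lemma SmoothOn.dtime_dspace {f : ℝ → ℝ → E} (hf : SmoothOn U f) (hU : IsOpen U)
    {t x : ℝ} (hp : (t, x) ∈ U) :
    _root_.dtime (_root_.dspace f) t x = _root_.dspace (_root_.dtime f) t x := by
  have hsymm : IsSymmSndFDerivAt ℝ (Function.uncurry f) (t, x) :=
    (hf.contDiffAt (hU.mem_nhds hp)).isSymmSndFDerivAt (by
      simpa using WithTop.coe_le_coe.2 (le_top : (2 : ℕ∞) ≤ ⊤))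
  have hd : HasFDerivAt (fderiv ℝ (Function.uncurry f))
      (fderiv ℝ (fderiv ℝ (Function.uncurry f)) (t, x)) (t, x) :=
    ((((hf.fderiv_of_isOpen hU (m := (⊤ : ℕ∞)) (by simp))).contDiffAt
      (hU.mem_nhds hp)).differentiableAt (by simp)).hasFDerivAt
  have h1 : HasDerivAt (fun u => fderiv ℝ (Function.uncurry f) (u, x) (0, 1))
      (fderiv ℝ (fderiv ℝ (Function.uncurry f)) (t, x) (1, 0) (0, 1)) t := by
    have := HasFDerivAt.comp_hasDerivAt (f := fun u => (u, x)) t hd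
      ((hasDerivAt_id t).prodMk (hasDerivAt_const t x))
    simpa using this.clm_apply (hasDerivAt_const t ((0 : ℝ), (1 : ℝ)))
  have h2 : HasDerivAt (fun y => fderiv ℝ (Function.uncurry f) (t, y) (1, 0))
      (fderiv ℝ (fderiv ℝ (Function.uncurry f)) (t, x) (0, 1) (1, 0)) x := by
    have := HasFDerivAt.comp_hasDerivAt (f := fun y => (t, y)) x hd
      ((hasDerivAt_const x t).prodMk (hasDerivAt_id x))
    simpa using this.clm_apply (hasDerivAt_const x ((1 : ℝ), (0 : ℝ)))
  have e1 : (fun u => _root_.dspace f u x) =ᶠ[nhds t]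
      fun u => fderiv ℝ (Function.uncurry f) (u, x) (0, 1) := by
    have : ∀ᶠ u in nhds t, (u, x) ∈ U :=
      (Continuous.prodMk_left x).continuousAt.eventually (hU.mem_nhds hp)
    filter_upwards [this] with u hu using (hf.hasDerivAt_space_fderiv hU hu).deriv
  have e2 : (fun y => _root_.dtime f t y) =ᶠ[nhds x]
      fun y => fderiv ℝ (Function.uncurry f) (t, y) (1, 0) := by
    have : ∀ᶠ y in nhds x, (t, y) ∈ U :=
      (Continuous.prodMk_right t).continuousAt.eventually (hU.mem_nhds hp)
    filter_upwards [this] with y hy using (hf.hasDerivAt_time_fderiv hU hy).deriv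
  calc _root_.dtime (_root_.dspace f) t x = _ := (h1.congr_of_eventuallyEq e1).deriv
    _ = _ := hsymm (1, 0) (0, 1)
    _ = _ := (h2.congr_of_eventuallyEq e2).deriv.symm

lemma SmoothOn.mul {f g : ℝ → ℝ → ℝ} (hf : SmoothOn U f) (hg : SmoothOn U g) :
    SmoothOn U (fun t x => f t x * g t x) := ContDiffOn.mul hf hg

lemma SmoothOn.add {f g : ℝ → ℝ → ℝ} (hf : SmoothOn U f) (hg : SmoothOn U g) :
    SmoothOn U (fun t x => f t x + g t x) := ContDiffOn.add hf hg

lemma SmoothOn.sub {f g : ℝ → ℝ → ℝ} (hf : SmoothOn U f) (hg : SmoothOn U g) :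
    SmoothOn U (fun t x => f t x - g t x) := ContDiffOn.sub hf hg

lemma SmoothOn.pow {f : ℝ → ℝ → ℝ} (hf : SmoothOn U f) (n : ℕ) :
    SmoothOn U (fun t x => f t x ^ n) := ContDiffOn.pow hf n

lemma SmoothOn.inv {f : ℝ → ℝ → ℝ} (hf : SmoothOn U f) (h0 : ∀ p ∈ U, f p.1 p.2 ≠ 0) :
    SmoothOn U (fun t x => (f t x)⁻¹) := ContDiffOn.inv hf h0

lemma SmoothOn.const_mul {f : ℝ → ℝ → ℝ} (c : ℝ) (hf : SmoothOn U f) :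
    SmoothOn U (fun t x => c * f t x) := ContDiffOn.mul contDiffOn_const hf

lemma SmoothOn.continuousOn_space {f : ℝ → ℝ → E} (hf : SmoothOn U f) {t : ℝ} {s : Set ℝ}
    (hs : ∀ x ∈ s, (t, x) ∈ U) : ContinuousOn (f t) s :=
  ContinuousOn.comp (f := fun x => (t, x)) hf.continuousOn (by fun_prop) hs

/-- Differentiation under the integral sign along a compact space interval inside `U`. -/
lemma SmoothOn.hasDerivAt_integral {f : ℝ → ℝ → ℝ} (hf : SmoothOn U f) (hU : IsOpen U)
    {t a b : ℝ} (hab : a ≤ b) (ht : ∀ x ∈ Icc a b, (t, x) ∈ U) :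
    HasDerivAt (fun u => ∫ x in a..b, f u x) (∫ x in a..b, _root_.dtime f t x) t := by
  obtain ⟨u, v, hu, -, htu, hv, huv⟩ := generalized_tube_lemma (isCompact_singleton (x := t))
    (isCompact_Icc (a := a) (b := b)) hU (by rintro ⟨s, x⟩ ⟨hs, hx⟩; cases hs; exact ht x hx)
  obtain ⟨ε, hε, hball⟩ := Metric.isOpen_iff.1 hu t (htu rfl)
  have hsub : ∀ s ∈ Metric.closedBall t (ε / 2), ∀ x ∈ Icc a b, (s, x) ∈ U := fun s hs x hx =>
    huv ⟨hball (Metric.closedBall_subset_ball (by linarith) hs), hv hx⟩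
  have hcpt : IsCompact (Metric.closedBall t (ε / 2) ×ˢ Icc a b) :=
    (isCompact_closedBall _ _).prod isCompact_Icc
  obtain ⟨C, hC⟩ := hcpt.exists_bound_of_continuousOn
    ((hf.dtime hU).continuousOn.mono fun p hp => hsub p.1 hp.1 p.2 hp.2)
  have hs : Metric.closedBall t (ε / 2) ∈ nhds t := Metric.closedBall_mem_nhds t (by linarith)
  have hmem : ∀ x ∈ uIoc a b, x ∈ Icc a b := fun x hx => by
    rw [uIoc_of_le hab] at hx; exact Ioc_subset_Icc_self hx
  have hmeas : ∀ g : ℝ → ℝ, ContinuousOn g (Icc a b) →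
      AEStronglyMeasurable g (volume.restrict (uIoc a b)) := fun g hg =>
    (hg.mono hmem).aestronglyMeasurable measurableSet_uIoc
  refine (intervalIntegral.hasDerivAt_integral_of_dominated_loc_of_deriv_le
    (F' := _root_.dtime f) (bound := fun _ => C) hs ?_ ?_ ?_ ?_ ?_ ?_).2
  · filter_upwards [hs] with s hs using hmeas _ (hf.continuousOn_space (hsub s hs))
  · exact ContinuousOn.intervalIntegrable_of_Icc hab (hf.continuousOn_space ht)
  · exact hmeas _ ((hf.dtime hU).continuousOn_space ht)
  · exact Filter.Eventually.of_forall fun x hx s hs => hC (s, x) ⟨hs, hmem x hx⟩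
  · exact intervalIntegrable_const
  · exact Filter.Eventually.of_forall fun x hx s hs =>
      hf.hasDerivAt_time hU (hsub s hs x (hmem x hx))

end TwoParameter

/-- Functions which agree on `[a, b]` have the same derivatives there, endpoints included. -/
lemma HasDerivAt.unique_of_eqOn_Icc {f g : ℝ → ℝ} {a b x f' g' : ℝ} (hab : a < b)
    (h : EqOn f g (Icc a b)) (hx : x ∈ Icc a b) (hf : HasDerivAt f f' x)
    (hg : HasDerivAt g g' x) : f' = g' :=
  (uniqueDiffOn_Icc hab x hx).eq_deriv _ hf.hasDerivWithinAt
    (hg.hasDerivWithinAt.congr h (h hx))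

section Weighted

/-- Integral over `[-1, 1]` against the weight `w`. -/
def wint (w f : ℝ → ℝ) : ℝ := ∫ x in (-1:ℝ)..1, f x * w x

/-- The `L²` norm over `[-1, 1]` with respect to the weight `w`. -/
def wnorm (w f : ℝ → ℝ) : ℝ := √(wint w fun x => f x ^ 2)

variable {w f g p u v f' g' : ℝ → ℝ}

lemma ContinuousOn.intervalIntegrable_unit (hf : ContinuousOn f (Icc (-1) 1)) :
    IntervalIntegrable f volume (-1) 1 :=
  hf.intervalIntegrable_of_Icc (by norm_num)

lemma wint_congr (h : EqOn f g (Icc (-1) 1)) : wint w f = wint w g := by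
  refine intervalIntegral.integral_congr fun x hx => ?_
  rw [uIcc_of_le (by norm_num)] at hx
  simp only [h hx]

lemma wint_mono (hw : ContinuousOn w (Icc (-1) 1)) (hw0 : ∀ x ∈ Icc (-1:ℝ) 1, 0 ≤ w x)
    (hf : ContinuousOn f (Icc (-1) 1)) (hg : ContinuousOn g (Icc (-1) 1))
    (h : ∀ x ∈ Icc (-1:ℝ) 1, f x ≤ g x) : wint w f ≤ wint w g :=
  intervalIntegral.integral_mono_on (by norm_num) (hf.mul hw).intervalIntegrable_unit
    (hg.mul hw).intervalIntegrable_unit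
    fun x hx => mul_le_mul_of_nonneg_right (h x hx) (hw0 x hx)

lemma wint_nonneg (hw0 : ∀ x ∈ Icc (-1:ℝ) 1, 0 ≤ w x)
    (hf : ∀ x ∈ Icc (-1:ℝ) 1, 0 ≤ f x) : 0 ≤ wint w f :=
  intervalIntegral.integral_nonneg (by norm_num) fun x hx => mul_nonneg (hf x hx) (hw0 x hx)

lemma wint_add (hw : ContinuousOn w (Icc (-1) 1)) (hf : ContinuousOn f (Icc (-1) 1))
    (hg : ContinuousOn g (Icc (-1) 1)) :
    wint w (fun x => f x + g x) = wint w f + wint w g := by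
  simp only [wint, add_mul]
  exact intervalIntegral.integral_add (hf.mul hw).intervalIntegrable_unit
    (hg.mul hw).intervalIntegrable_unit

lemma wint_const_mul (c : ℝ) : wint w (fun x => c * f x) = c * wint w f := by
  simp only [wint, mul_assoc]
  exact intervalIntegral.integral_const_mul _ _

lemma wint_sub (hw : ContinuousOn w (Icc (-1) 1)) (hf : ContinuousOn f (Icc (-1) 1))
    (hg : ContinuousOn g (Icc (-1) 1)) :
    wint w (fun x => f x - g x) = wint w f - wint w g := by
  simp only [wint, sub_mul]
  exact intervalIntegral.integral_sub (hf.mul hw).intervalIntegrable_unit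
    (hg.mul hw).intervalIntegrable_unit

lemma wnorm_nonneg : 0 ≤ wnorm w f := sqrt_nonneg _

lemma wnorm_sq (hw0 : ∀ x ∈ Icc (-1:ℝ) 1, 0 ≤ w x) :
    wnorm w f ^ 2 = wint w fun x => f x ^ 2 :=
  sq_sqrt (wint_nonneg hw0 fun _ _ => sq_nonneg _)

/-- Cauchy-Schwarz for the weighted integral. -/
lemma wint_abs_mul_abs_le (hw : ContinuousOn w (Icc (-1) 1)) (hw0 : ∀ x ∈ Icc (-1:ℝ) 1, 0 ≤ w x)
    (hf : ContinuousOn f (Icc (-1) 1)) (hg : ContinuousOn g (Icc (-1) 1)) :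
    wint w (fun x => |f x| * |g x|) ≤ wnorm w f * wnorm w g := by
  have key : ∀ l : ℝ, 0 ≤ (wint w fun x => f x ^ 2) * (l * l) +
      (-2 * wint w fun x => |f x| * |g x|) * l + wint w fun x => g x ^ 2 := by
    intro l
    have h0 : 0 ≤ wint w fun x => (l * |f x| - |g x|) ^ 2 :=
      wint_nonneg hw0 fun _ _ => sq_nonneg _
    have h1 : (wint w fun x => (l * |f x| - |g x|) ^ 2) =
        wint w fun x => (l * l) * f x ^ 2 + ((-2 * l) * (|f x| * |g x|) + g x ^ 2) :=
      wint_congr fun x _ => by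
        have h3 := sq_abs (f x)
        have h4 := sq_abs (g x)
        linear_combination l ^ 2 * h3 + h4
    rw [h1, wint_add hw (by fun_prop) (by fun_prop), wint_add hw (by fun_prop) (by fun_prop),
      wint_const_mul, wint_const_mul] at h0
    linarith
  have hd := discrim_le_zero key
  rw [discrim] at hd
  refine abs_le_of_sq_le_sq' ?_ (mul_nonneg wnorm_nonneg wnorm_nonneg) |>.2
  rw [mul_pow, wnorm_sq hw0, wnorm_sq hw0]
  linarith

/-- Cauchy-Schwarz with a bounded factor. -/
lemma wint_mul_mul_le {M : ℝ} (hw : ContinuousOn w (Icc (-1) 1))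
    (hw0 : ∀ x ∈ Icc (-1:ℝ) 1, 0 ≤ w x) (hp : ContinuousOn p (Icc (-1) 1))
    (hu : ContinuousOn u (Icc (-1) 1)) (hv : ContinuousOn v (Icc (-1) 1))
    (hM : ∀ x ∈ Icc (-1:ℝ) 1, |p x| ≤ M) :
    wint w (fun x => p x * (u x * v x)) ≤ M * (wnorm w u * wnorm w v) := by
  have hM0 : 0 ≤ M := (abs_nonneg _).trans (hM 0 (by norm_num))
  calc wint w (fun x => p x * (u x * v x)) ≤ wint w (fun x => M * (|u x| * |v x|)) := by
        refine wint_mono hw hw0 (by fun_prop) (by fun_prop) fun x hx => ?_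
        calc _ ≤ |p x * (u x * v x)| := le_abs_self _
          _ = |p x| * (|u x| * |v x|) := by rw [abs_mul, abs_mul]
          _ ≤ _ := by gcongr; exact hM x hx
    _ = M * wint w (fun x => |u x| * |v x|) := wint_const_mul _
    _ ≤ _ := by gcongr; exact wint_abs_mul_abs_le hw hw0 hu hv

lemma wint_mul_deriv (hw : ContinuousOn w (Icc (-1) 1))
    (hf : ∀ x ∈ Icc (-1:ℝ) 1, HasDerivAt f (w x * f' x) x)
    (hg : ∀ x ∈ Icc (-1:ℝ) 1, HasDerivAt g (w x * g' x) x)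
    (hf' : ContinuousOn f' (Icc (-1) 1)) (hg' : ContinuousOn g' (Icc (-1) 1)) :
    wint w (fun x => f x * g' x) =
      f 1 * g 1 - f (-1) * g (-1) - wint w (fun x => f' x * g x) := by
  have hI : uIcc (-1:ℝ) 1 = Icc (-1) 1 := uIcc_of_le (by norm_num)
  have := intervalIntegral.integral_mul_deriv_eq_deriv_mul (a := -1) (b := 1) (u := f) (v := g)
    (u' := fun x => w x * f' x) (v' := fun x => w x * g' x)
    (fun x hx => hf x (hI ▸ hx)) (fun x hx => hg x (hI ▸ hx))
    (hw.mul hf').intervalIntegrable_unit (hw.mul hg').intervalIntegrable_unit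
  have e1 : wint w (fun x => f x * g' x) = ∫ x in (-1:ℝ)..1, f x * (w x * g' x) :=
    intervalIntegral.integral_congr fun x _ => by ring
  have e2 : wint w (fun x => f' x * g x) = ∫ x in (-1:ℝ)..1, w x * f' x * g x :=
    intervalIntegral.integral_congr fun x _ => by ring
  rw [e1, e2, this]

lemma abs_sub_le_integral (hw : ContinuousOn w (Icc (-1) 1))
    (hw0 : ∀ x ∈ Icc (-1:ℝ) 1, 0 ≤ w x)
    (hf : ∀ x ∈ Icc (-1:ℝ) 1, HasDerivAt f (w x * f' x) x)
    (hf' : ContinuousOn f' (Icc (-1) 1)) {x y : ℝ} (hx : -1 ≤ x) (hxy : x ≤ y) (hy : y ≤ 1) :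
    |f y - f x| ≤ ∫ z in x..y, |f' z| * w z := by
  have hsub : Icc x y ⊆ Icc (-1) 1 := Icc_subset_Icc hx hy
  rw [← intervalIntegral.integral_eq_sub_of_hasDerivAt (f := f) (f' := fun z => w z * f' z)
    (fun z hz => hf z (hsub (uIcc_of_le hxy ▸ hz)))
    (((hw.mul hf').mono hsub).intervalIntegrable_of_Icc hxy)]
  refine (intervalIntegral.norm_integral_le_integral_norm (f := fun z => w z * f' z)
    hxy).trans (le_of_eq ?_)
  refine intervalIntegral.integral_congr fun z hz => ?_
  rw [uIcc_of_le hxy] at hz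
  simp only [norm_eq_abs, abs_mul, abs_of_nonneg (hw0 z (hsub hz))]
  ring

lemma wint_abs_le_wnorm (hw : ContinuousOn w (Icc (-1) 1))
    (hw0 : ∀ x ∈ Icc (-1:ℝ) 1, 0 ≤ w x) (h1 : wint w (fun _ => 1) = 1)
    (hf : ContinuousOn f (Icc (-1) 1)) : wint w (fun x => |f x|) ≤ wnorm w f := by
  have := wint_abs_mul_abs_le hw hw0 hf (g := fun _ => 1) continuousOn_const
  simpa [wnorm, h1] using this

lemma intervalIntegrable_abs_mul (hw : ContinuousOn w (Icc (-1) 1))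
    (hf : ContinuousOn f (Icc (-1) 1)) {x y : ℝ} (hx : -1 ≤ x) (hxy : x ≤ y) (hy : y ≤ 1) :
    IntervalIntegrable (fun z => |f z| * w z) volume x y :=
  ((hf.abs.mul hw).mono (Icc_subset_Icc hx hy)).intervalIntegrable_of_Icc hxy

/-- For a weight of unit mass, the oscillation is bounded by the norm of the derivative. -/
lemma abs_sub_le_wnorm (hw : ContinuousOn w (Icc (-1) 1))
    (hw0 : ∀ x ∈ Icc (-1:ℝ) 1, 0 ≤ w x) (h1 : wint w (fun _ => 1) = 1)
    (hf : ∀ x ∈ Icc (-1:ℝ) 1, HasDerivAt f (w x * f' x) x)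
    (hf' : ContinuousOn f' (Icc (-1) 1)) {x y : ℝ} (hx : x ∈ Icc (-1:ℝ) 1)
    (hy : y ∈ Icc (-1:ℝ) 1) : |f x - f y| ≤ wnorm w f' := by
  wlog hxy : y ≤ x generalizing x y
  · rw [abs_sub_comm]
    exact this hy hx (le_of_not_ge hxy)
  refine (abs_sub_le_integral hw hw0 hf hf' hy.1 hxy hx.2).trans
    (le_trans ?_ (wint_abs_le_wnorm hw hw0 h1 hf'))
  refine intervalIntegral.integral_mono_interval hy.1 hxy hx.2 ?_
    (intervalIntegrable_abs_mul hw hf' le_rfl (by norm_num) le_rfl)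
  filter_upwards [ae_restrict_mem measurableSet_Ioc] with z hz
  exact mul_nonneg (abs_nonneg _) (hw0 z (Ioc_subset_Icc_self hz))

/-- Sup bound for functions vanishing at both endpoints. -/
lemma abs_le_half_wnorm (hw : ContinuousOn w (Icc (-1) 1))
    (hw0 : ∀ x ∈ Icc (-1:ℝ) 1, 0 ≤ w x) (h1 : wint w (fun _ => 1) = 1)
    (hf : ∀ x ∈ Icc (-1:ℝ) 1, HasDerivAt f (w x * f' x) x)
    (hf' : ContinuousOn f' (Icc (-1) 1)) (hl : f (-1) = 0) (hr : f 1 = 0) {x : ℝ}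
    (hx : x ∈ Icc (-1:ℝ) 1) : |f x| ≤ wnorm w f' / 2 := by
  have e1 := abs_sub_le_integral hw hw0 hf hf' le_rfl hx.1 hx.2
  have e2 := abs_sub_le_integral hw hw0 hf hf' hx.1 hx.2 le_rfl
  have e3 := intervalIntegral.integral_add_adjacent_intervals
    (intervalIntegrable_abs_mul hw hf' le_rfl hx.1 hx.2)
    (intervalIntegrable_abs_mul hw hf' hx.1 hx.2 le_rfl)
  have e4 := wint_abs_le_wnorm hw hw0 h1 hf'
  rw [wint, ← e3] at e4
  rw [hl, sub_zero] at e1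
  rw [hr, zero_sub, abs_neg] at e2
  linarith

/-- Sup bound for functions with vanishing weighted mean. -/
lemma abs_le_wnorm_of_mean_zero (hw : ContinuousOn w (Icc (-1) 1))
    (hw0 : ∀ x ∈ Icc (-1:ℝ) 1, 0 ≤ w x) (h1 : wint w (fun _ => 1) = 1)
    (hf : ∀ x ∈ Icc (-1:ℝ) 1, HasDerivAt f (w x * f' x) x)
    (hf' : ContinuousOn f' (Icc (-1) 1)) (h0 : wint w f = 0) {x : ℝ}
    (hx : x ∈ Icc (-1:ℝ) 1) : |f x| ≤ wnorm w f' := by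
  have hfc : ContinuousOn f (Icc (-1) 1) :=
    fun y hy => (hf y hy).continuousAt.continuousWithinAt
  have e : f x = wint w (fun y => f x * 1 - f y) := by
    rw [wint_sub hw continuousOn_const hfc, wint_const_mul, h1, h0]; ring
  have b : ∀ y ∈ Icc (-1:ℝ) 1, |f x * 1 - f y| ≤ wnorm w f' * 1 := fun y hy => by
    simpa using abs_sub_le_wnorm hw hw0 h1 hf hf' hx hy
  have c : ContinuousOn (fun y => f x * 1 - f y) (Icc (-1) 1) := continuousOn_const.sub hfc
  rw [e, abs_le]
  constructor
  · have := wint_mono (f := fun _ => -wnorm w f' * 1) hw hw0 continuousOn_const c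
      fun y hy => by linarith [(abs_le.1 (b y hy)).1]
    rw [wint_const_mul, h1] at this
    linarith
  · have := wint_mono (g := fun _ => wnorm w f' * 1) hw hw0 c continuousOn_const
      fun y hy => (abs_le.1 (b y hy)).2
    rw [wint_const_mul, h1] at this
    linarith

/-- `‖f‖ ≤ M` for functions bounded by `M`, for a weight of unit mass. -/
lemma wnorm_le_of_abs_le {M : ℝ} (hw : ContinuousOn w (Icc (-1) 1))
    (hw0 : ∀ x ∈ Icc (-1:ℝ) 1, 0 ≤ w x) (h1 : wint w (fun _ => 1) = 1)
    (hf : ContinuousOn f (Icc (-1) 1)) (hM : ∀ x ∈ Icc (-1:ℝ) 1, |f x| ≤ M) :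
    wnorm w f ≤ M := by
  have hM0 : 0 ≤ M := (abs_nonneg _).trans (hM 0 (by norm_num))
  refine abs_le_of_sq_le_sq' ?_ hM0 |>.2
  rw [wnorm_sq hw0]
  have := wint_mono (f := fun x => f x ^ 2) (g := fun _ => M ^ 2 * 1) hw hw0 (by fun_prop)
    continuousOn_const
    fun x hx => by simpa using sq_le_sq' (neg_le_of_abs_le (hM x hx)) (le_of_abs_le (hM x hx))
  rwa [wint_const_mul, h1, mul_one] at this

/-- Interpolation: `‖f'‖² ≤ ‖f‖ ‖f''‖` when `f f'` vanishes at the endpoints. -/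
lemma wnorm_sq_le_mul {f'' : ℝ → ℝ} (hw : ContinuousOn w (Icc (-1) 1))
    (hw0 : ∀ x ∈ Icc (-1:ℝ) 1, 0 ≤ w x)
    (hf : ∀ x ∈ Icc (-1:ℝ) 1, HasDerivAt f (w x * f' x) x)
    (hf' : ∀ x ∈ Icc (-1:ℝ) 1, HasDerivAt f' (w x * f'' x) x)
    (hf'' : ContinuousOn f'' (Icc (-1) 1)) (hl : f' (-1) * f (-1) = 0) (hr : f' 1 * f 1 = 0) :
    wnorm w f' ^ 2 ≤ wnorm w f * wnorm w f'' := by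
  have hfc : ContinuousOn f (Icc (-1) 1) :=
    fun y hy => (hf y hy).continuousAt.continuousWithinAt
  have hfc' : ContinuousOn f' (Icc (-1) 1) :=
    fun y hy => (hf' y hy).continuousAt.continuousWithinAt
  have := wint_mul_deriv hw hf' hf hf'' hfc'
  rw [hl, hr, sub_zero, zero_sub] at this
  rw [wnorm_sq hw0]
  calc wint w (fun x => f' x ^ 2) = wint w (fun x => f' x * f' x) :=
        wint_congr fun x _ => sq (f' x)
    _ = -1 * wint w (fun x => f'' x * f x) := by rw [this]; ring
    _ = wint w (fun x => -1 * (f x * f'' x)) := by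
        rw [← wint_const_mul]; exact wint_congr fun x _ => by ring
    _ ≤ 1 * (wnorm w f * wnorm w f'') :=
        wint_mul_mul_le hw hw0 continuousOn_const hfc hf'' fun x _ => by norm_num
    _ = _ := one_mul _

end Weighted

section EnergyRate

/-- The density of `d/dt ‖k_{ss}‖₂²` after integration by parts, as a polynomial in
`k, k_s, …, k_{s⁵}`. -/
def rateDensity (k : ℕ → ℝ → ℝ) (x : ℝ) : ℝ :=
  -2 * k 5 x * (k 5 x + k 0 x * k 1 x * k 2 x + k 0 x ^ 2 * k 3 x - 1 / 2 * k 1 x ^ 3) +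
    (k 4 x + k 0 x ^ 2 * k 2 x - 1 / 2 * k 0 x * k 1 x ^ 2) *
      (2 * k 0 x ^ 2 * k 4 x - 2 * k 0 x * k 1 x * k 3 x + k 0 x * k 2 x ^ 2)

lemma rate_bound_of_interpolation {a₁ a₂ a₃ a₄ a₅ : ℝ} (h₁ : 0 ≤ a₁) (h₂ : 0 ≤ a₂) (h₃ : 0 ≤ a₃)
    (h₄ : 0 ≤ a₄) (h₅ : 0 ≤ a₅) (hA : a₁ ^ 2 ≤ 4 / 5) (i₂ : a₂ ^ 2 ≤ a₁ * a₃)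
    (i₃ : a₃ ^ 2 ≤ a₂ * a₄) (p₂ : a₂ ≤ a₃ / 2) (p₃ : a₃ ≤ a₄ / 2) (p₄ : a₄ ≤ a₅ / 2) :
    -2 * (a₅ * a₅) + 2 * (a₁ * (a₂ / 2)) * (a₅ * a₂) + 2 * a₁ ^ 2 * (a₅ * a₃) +
      (a₂ / 2) ^ 2 * (a₅ * a₁) + 2 * a₁ ^ 2 * (a₄ * a₄) + 2 * (a₁ * (a₄ / 2)) * (a₁ * a₄) +
      a₁ * a₃ * (a₂ * a₄) + 2 * a₁ ^ 4 * (a₂ * a₄) + 2 * (a₁ ^ 3 * (a₂ / 2)) * (a₂ * a₃) +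
      a₁ ^ 3 * a₃ * (a₂ * a₂) + a₁ ^ 3 * (a₂ / 2) * (a₁ * a₄) +
      a₁ ^ 2 * (a₂ / 2) ^ 2 * (a₁ * a₃) + 1 / 2 * (a₁ ^ 2 * (a₂ / 2) ^ 2) * (a₂ * a₂) ≤
      -a₂ ^ 2 := by
  have i₂₃ : a₂ * a₃ ≤ a₁ * a₄ := by
    by_contra! h
    have h0 : 0 ≤ a₁ * a₄ := by positivity
    have : (a₂ * a₃) * (a₂ * a₃) ≤ (a₂ * a₃) * (a₁ * a₄) := by
      have := mul_le_mul i₂ i₃ (sq_nonneg _) (by positivity)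
      linarith
    exact absurd (le_of_mul_le_mul_left this (h0.trans_lt h)) (not_le.2 h)
  have q₃₅ : a₃ * a₅ ≤ a₅ ^ 2 / 4 := by nlinarith
  have q₄₄ : a₄ * a₄ ≤ a₅ ^ 2 / 4 := by nlinarith
  have q₂₄ : a₂ * a₄ ≤ a₅ ^ 2 / 16 := by nlinarith
  have q₂₂ : a₂ ^ 2 ≤ a₅ ^ 2 / 64 := by nlinarith
  have c₁ : a₁ * a₂ ^ 2 * a₅ ≤ a₁ ^ 2 * (a₃ * a₅) := by
    calc a₁ * a₂ ^ 2 * a₅ ≤ a₁ * (a₁ * a₃) * a₅ := by gcongr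
      _ = _ := by ring
  have c₂ : a₁ * a₃ * (a₂ * a₄) ≤ a₁ ^ 2 * (a₄ * a₄) := by
    calc a₁ * a₃ * (a₂ * a₄) = a₁ * (a₂ * a₃) * a₄ := by ring
      _ ≤ a₁ * (a₁ * a₄) * a₄ := by gcongr
      _ = _ := by ring
  have c₃ : a₁ ^ 3 * a₃ * a₂ ^ 2 ≤ (a₁ ^ 2) ^ 2 * (a₂ * a₄) := by
    calc a₁ ^ 3 * a₃ * a₂ ^ 2 = a₁ ^ 3 * a₂ * (a₂ * a₃) := by ring
      _ ≤ a₁ ^ 3 * a₂ * (a₁ * a₄) := by gcongr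
      _ = _ := by ring
  have c₄ : a₁ ^ 2 * a₂ ^ 2 * a₂ ^ 2 ≤ (a₁ ^ 2) ^ 2 * (a₂ * a₄) := by
    calc a₁ ^ 2 * a₂ ^ 2 * a₂ ^ 2 ≤ a₁ ^ 2 * a₂ ^ 2 * (a₁ * a₃) := by gcongr
      _ = a₁ ^ 3 * a₃ * a₂ ^ 2 := by ring
      _ ≤ _ := c₃
  have d₁ : a₁ ^ 2 * (a₃ * a₅) ≤ 4 / 5 * (a₅ ^ 2 / 4) := by gcongr
  have d₂ : a₁ ^ 2 * (a₄ * a₄) ≤ 4 / 5 * (a₅ ^ 2 / 4) := by gcongr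
  have d₃ : (a₁ ^ 2) ^ 2 * (a₂ * a₄) ≤ (4 / 5) ^ 2 * (a₅ ^ 2 / 16) := by gcongr
  linarith [mul_nonneg h₅ h₅]

/-- A continuous function with weighted integral at most `M`. -/
def WintLE (w f : ℝ → ℝ) (M : ℝ) : Prop := ContinuousOn f (Icc (-1) 1) ∧ wint w f ≤ M

lemma WintLE.add {w f g : ℝ → ℝ} {M N : ℝ} (hw : ContinuousOn w (Icc (-1) 1))
    (hf : WintLE w f M) (hg : WintLE w g N) : WintLE w (fun x => f x + g x) (M + N) :=
  ⟨hf.1.add hg.1, (wint_add hw hf.1 hg.1).trans_le (add_le_add hf.2 hg.2)⟩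

lemma WintLE.of_mul_mul {w p u v : ℝ → ℝ} {M : ℝ} (hw : ContinuousOn w (Icc (-1) 1))
    (hw0 : ∀ x ∈ Icc (-1:ℝ) 1, 0 ≤ w x) (hp : ContinuousOn p (Icc (-1) 1))
    (hu : ContinuousOn u (Icc (-1) 1)) (hv : ContinuousOn v (Icc (-1) 1))
    (hM : ∀ x ∈ Icc (-1:ℝ) 1, |p x| ≤ M) :
    WintLE w (fun x => p x * (u x * v x)) (M * (wnorm w u * wnorm w v)) :=
  ⟨hp.mul (hu.mul hv), wint_mul_mul_le hw hw0 hp hu hv hM⟩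

/-- **The energy estimate** for a weight of unit mass. -/
lemma wint_rateDensity_le_of_unit {w : ℝ → ℝ} {k : ℕ → ℝ → ℝ}
    (hw : ContinuousOn w (Icc (-1) 1)) (hw0 : ∀ x ∈ Icc (-1:ℝ) 1, 0 ≤ w x)
    (h1 : wint w (fun _ => 1) = 1)
    (hk : ∀ j, ∀ x ∈ Icc (-1:ℝ) 1, HasDerivAt (k j) (w x * k (j + 1) x) x)
    (hl1 : k 1 (-1) = 0) (hr1 : k 1 1 = 0) (hl3 : k 3 (-1) = 0) (hr3 : k 3 1 = 0)
    (h0 : wint w (k 0) = 0) (hA : wint w (fun x => k 1 x ^ 2) ≤ 4 / 5) :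
    wint w (rateDensity k) ≤ -wint w (fun x => k 2 x ^ 2) := by
  have hc : ∀ j, ContinuousOn (k j) (Icc (-1) 1) :=
    fun j y hy => (hk j y hy).continuousAt.continuousWithinAt
  have h02 : wint w (k 2) = 0 := by
    have := wint_mul_deriv (f := fun _ => 1) (f' := fun _ => 0) hw
      (fun x _ => by simpa using hasDerivAt_const x (1:ℝ)) (hk 1) continuousOn_const (hc 2)
    simpa [hl1, hr1, wint] using this
  set a₁ := wnorm w (k 1) with ha₁
  set a₂ := wnorm w (k 2) with ha₂
  set a₃ := wnorm w (k 3) with ha₃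
  set a₄ := wnorm w (k 4) with ha₄
  set a₅ := wnorm w (k 5) with ha₅
  have n₁ : 0 ≤ a₁ := wnorm_nonneg
  have n₂ : 0 ≤ a₂ := wnorm_nonneg
  have n₃ : 0 ≤ a₃ := wnorm_nonneg
  have n₄ : 0 ≤ a₄ := wnorm_nonneg
  have n₅ : 0 ≤ a₅ := wnorm_nonneg
  have s₀ : ∀ x ∈ Icc (-1:ℝ) 1, |k 0 x| ≤ a₁ :=
    fun x hx => abs_le_wnorm_of_mean_zero hw hw0 h1 (hk 0) (hc 1) h0 hx
  have s₁ : ∀ x ∈ Icc (-1:ℝ) 1, |k 1 x| ≤ a₂ / 2 :=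
    fun x hx => abs_le_half_wnorm hw hw0 h1 (hk 1) (hc 2) hl1 hr1 hx
  have s₂ : ∀ x ∈ Icc (-1:ℝ) 1, |k 2 x| ≤ a₃ :=
    fun x hx => abs_le_wnorm_of_mean_zero hw hw0 h1 (hk 2) (hc 3) h02 hx
  have s₃ : ∀ x ∈ Icc (-1:ℝ) 1, |k 3 x| ≤ a₄ / 2 :=
    fun x hx => abs_le_half_wnorm hw hw0 h1 (hk 3) (hc 4) hl3 hr3 hx
  have p₁ : a₁ ≤ a₂ / 2 := wnorm_le_of_abs_le hw hw0 h1 (hc 1) s₁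
  have p₃ : a₃ ≤ a₄ / 2 := wnorm_le_of_abs_le hw hw0 h1 (hc 3) s₃
  have i₂ : a₂ ^ 2 ≤ a₁ * a₃ :=
    wnorm_sq_le_mul hw hw0 (hk 1) (hk 2) (hc 3) (by simp [hl1]) (by simp [hr1])
  have i₃ : a₃ ^ 2 ≤ a₂ * a₄ :=
    wnorm_sq_le_mul hw hw0 (hk 2) (hk 3) (hc 4) (by simp [hl3]) (by simp [hr3])
  have i₄ : a₄ ^ 2 ≤ a₃ * a₅ :=
    wnorm_sq_le_mul hw hw0 (hk 3) (hk 4) (hc 5) (by simp [hl3]) (by simp [hr3])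
  have half : ∀ {a b c : ℝ}, 0 ≤ a → 0 ≤ b → 0 ≤ c → b ^ 2 ≤ a * c → a ≤ b / 2 → b ≤ c / 2 := by
    intro a b c ha hb hc h1 h2
    by_contra! h
    nlinarith
  have p₂ : a₂ ≤ a₃ / 2 := half n₁ n₂ n₃ i₂ p₁
  have p₄ : a₄ ≤ a₅ / 2 := half n₃ n₄ n₅ i₄ p₃
  have hA' : a₁ ^ 2 ≤ 4 / 5 := by rwa [ha₁, wnorm_sq hw0]
  have hc0 := hc 0
  have hc1 := hc 1
  have hc2 := hc 2
  have hc3 := hc 3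
  have hc4 := hc 4
  have hc5 := hc 5
  have T₀ : WintLE w (fun x => -2 * k 5 x ^ 2) (-2 * (a₅ * a₅)) :=
    ⟨by fun_prop, by rw [wint_const_mul, ← sq, ha₅, wnorm_sq hw0]⟩
  have T₁ : WintLE w (fun x => (-2 * (k 0 x * k 1 x)) * (k 5 x * k 2 x))
      (2 * (a₁ * (a₂ / 2)) * (a₅ * a₂)) :=
    .of_mul_mul hw hw0 (by fun_prop) hc5 hc2 fun x hx => by
      have := s₀ x hx; have := s₁ x hx
      rw [abs_mul, abs_mul, abs_neg, abs_two]; gcongr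
  have T₂ : WintLE w (fun x => (-2 * k 0 x ^ 2) * (k 5 x * k 3 x))
      (2 * a₁ ^ 2 * (a₅ * a₃)) :=
    .of_mul_mul hw hw0 (by fun_prop) hc5 hc3 fun x hx => by
      have := s₀ x hx
      rw [abs_mul, abs_pow, abs_neg, abs_two]; gcongr
  have T₃ : WintLE w (fun x => k 1 x ^ 2 * (k 5 x * k 1 x))
      ((a₂ / 2) ^ 2 * (a₅ * a₁)) :=
    .of_mul_mul hw hw0 (by fun_prop) hc5 hc1 fun x hx => by
      have := s₁ x hx
      rw [abs_pow]; gcongr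
  have T₄ : WintLE w (fun x => (2 * k 0 x ^ 2) * (k 4 x * k 4 x))
      (2 * a₁ ^ 2 * (a₄ * a₄)) :=
    .of_mul_mul hw hw0 (by fun_prop) hc4 hc4 fun x hx => by
      have := s₀ x hx
      rw [abs_mul, abs_pow, abs_two]; gcongr
  have T₅ : WintLE w (fun x => (-2 * (k 0 x * k 3 x)) * (k 1 x * k 4 x))
      (2 * (a₁ * (a₄ / 2)) * (a₁ * a₄)) :=
    .of_mul_mul hw hw0 (by fun_prop) hc1 hc4 fun x hx => by
      have := s₀ x hx; have := s₃ x hx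
      rw [abs_mul, abs_mul, abs_neg, abs_two]; gcongr
  have T₆ : WintLE w (fun x => (k 0 x * k 2 x) * (k 2 x * k 4 x))
      (a₁ * a₃ * (a₂ * a₄)) :=
    .of_mul_mul hw hw0 (by fun_prop) hc2 hc4 fun x hx => by
      have := s₀ x hx; have := s₂ x hx
      rw [abs_mul]; gcongr
  have T₇ : WintLE w (fun x => (2 * k 0 x ^ 4) * (k 2 x * k 4 x))
      (2 * a₁ ^ 4 * (a₂ * a₄)) :=
    .of_mul_mul hw hw0 (by fun_prop) hc2 hc4 fun x hx => by
      have := s₀ x hx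
      rw [abs_mul, abs_pow, abs_two]; gcongr
  have T₈ : WintLE w (fun x => (-2 * (k 0 x ^ 3 * k 1 x)) * (k 2 x * k 3 x))
      (2 * (a₁ ^ 3 * (a₂ / 2)) * (a₂ * a₃)) :=
    .of_mul_mul hw hw0 (by fun_prop) hc2 hc3 fun x hx => by
      have := s₀ x hx; have := s₁ x hx
      rw [abs_mul, abs_mul, abs_pow, abs_neg, abs_two]; gcongr
  have T₉ : WintLE w (fun x => (k 0 x ^ 3 * k 2 x) * (k 2 x * k 2 x))
      (a₁ ^ 3 * a₃ * (a₂ * a₂)) :=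
    .of_mul_mul hw hw0 (by fun_prop) hc2 hc2 fun x hx => by
      have := s₀ x hx; have := s₂ x hx
      rw [abs_mul, abs_pow]; gcongr
  have T₁₀ : WintLE w (fun x => (-(k 0 x ^ 3 * k 1 x)) * (k 1 x * k 4 x))
      (a₁ ^ 3 * (a₂ / 2) * (a₁ * a₄)) :=
    .of_mul_mul hw hw0 (by fun_prop) hc1 hc4 fun x hx => by
      have := s₀ x hx; have := s₁ x hx
      rw [abs_neg, abs_mul, abs_pow]; gcongr
  have T₁₁ : WintLE w (fun x => (k 0 x ^ 2 * k 1 x ^ 2) * (k 1 x * k 3 x))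
      (a₁ ^ 2 * (a₂ / 2) ^ 2 * (a₁ * a₃)) :=
    .of_mul_mul hw hw0 (by fun_prop) hc1 hc3 fun x hx => by
      have := s₀ x hx; have := s₁ x hx
      rw [abs_mul, abs_pow, abs_pow]; gcongr
  have T₁₂ : WintLE w (fun x => (-(1 / 2) * (k 0 x ^ 2 * k 1 x ^ 2)) * (k 2 x * k 2 x))
      (1 / 2 * (a₁ ^ 2 * (a₂ / 2) ^ 2) * (a₂ * a₂)) :=
    .of_mul_mul hw hw0 (by fun_prop) hc2 hc2 fun x hx => by
      have := s₀ x hx; have := s₁ x hx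
      rw [abs_mul, abs_mul, abs_pow, abs_pow, abs_neg, abs_of_pos (by norm_num : (0:ℝ) < 1 / 2)]
      gcongr
  have hsum := (T₀.add hw <| T₁.add hw <| T₂.add hw <| T₃.add hw <| T₄.add hw <| T₅.add hw <|
    T₆.add hw <| T₇.add hw <| T₈.add hw <| T₉.add hw <| T₁₀.add hw <| T₁₁.add hw T₁₂).2
  refine (wint_congr fun x _ => ?_).trans_le (hsum.trans ?_)
  · unfold rateDensity; ring
  have hfin := rate_bound_of_interpolation n₁ n₂ n₃ n₄ n₅ hA' i₂ i₃ p₂ p₃ p₄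
  rw [← wnorm_sq hw0]
  linarith

/-- **The energy estimate** for a weight of arbitrary total mass `L`. -/
lemma pow_mul_wint_rateDensity_le {w : ℝ → ℝ} {k : ℕ → ℝ → ℝ} {L : ℝ} (hL : 0 < L)
    (hw : ContinuousOn w (Icc (-1) 1)) (hw0 : ∀ x ∈ Icc (-1:ℝ) 1, 0 ≤ w x)
    (h1 : wint w (fun _ => 1) = L)
    (hk : ∀ j, ∀ x ∈ Icc (-1:ℝ) 1, HasDerivAt (k j) (w x * k (j + 1) x) x)
    (hl1 : k 1 (-1) = 0) (hr1 : k 1 1 = 0) (hl3 : k 3 (-1) = 0) (hr3 : k 3 1 = 0)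
    (h0 : wint w (k 0) = 0) (hA : wint w (fun x => k 1 x ^ 2) * L ^ 3 ≤ 4 / 5) :
    L ^ 6 * wint w (rateDensity k) ≤ -wint w (fun x => k 2 x ^ 2) := by
  have scale : ∀ f : ℝ → ℝ, wint (fun x => w x / L) f = wint w f / L := fun f => by
    simp only [wint, ← mul_div_assoc, intervalIntegral.integral_div]
  have main := wint_rateDensity_le_of_unit (w := fun x => w x / L)
    (k := fun j x => L ^ (j + 1) * k j x) (hw.div_const L)
    (fun x hx => div_nonneg (hw0 x hx) hL.le) (by rw [scale, h1, div_self hL.ne'])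
    (fun j x hx => by
      refine ((hk j x hx).const_mul (L ^ (j + 1))).congr_deriv ?_
      field_simp
      ring)
    (by simp [hl1]) (by simp [hr1]) (by simp [hl3]) (by simp [hr3])
    (by rw [scale, wint_const_mul, h0]; simp)
    (by
      have : wint w (fun x => (L ^ (1 + 1) * k 1 x) ^ 2) =
          wint w (fun x => L ^ 4 * k 1 x ^ 2) := wint_congr fun x _ => by ring
      rw [scale, this, wint_const_mul]
      refine le_of_eq_of_le ?_ hA
      field_simp)
  have e1 : wint w (rateDensity fun j x => L ^ (j + 1) * k j x) =
      wint w (fun x => L ^ 12 * rateDensity k x) :=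
    wint_congr fun x _ => by unfold rateDensity; ring
  have e2 : wint w (fun x => (L ^ (2 + 1) * k 2 x) ^ 2) =
      wint w (fun x => L ^ 6 * k 2 x ^ 2) := wint_congr fun x _ => by ring
  rw [scale, scale, e1, e2, wint_const_mul, wint_const_mul] at main
  have e3 : L ^ 12 * wint w (rateDensity k) / L = L ^ 5 * (L ^ 6 * wint w (rateDensity k)) := by
    field_simp
  have e4 : -(L ^ 6 * wint w (fun x => k 2 x ^ 2) / L) =
      L ^ 5 * -wint w (fun x => k 2 x ^ 2) := by
    field_simp
  exact le_of_mul_le_mul_left (e3 ▸ e4 ▸ main) (by positivity)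

end EnergyRate

section CurveFamily

lemma HasDerivAt.e2_apply {g : ℝ → E2} {g' : E2} {x : ℝ} (h : HasDerivAt g g' x) (i : Fin 2) :
    HasDerivAt (fun y => g y i) (g' i) x :=
  (EuclideanSpace.proj i : E2 →L[ℝ] ℝ).hasFDerivAt.comp_hasDerivAt x h

lemma SmoothOn.e2_apply {U : Set (ℝ × ℝ)} {f : ℝ → ℝ → E2} (hf : SmoothOn U f) (i : Fin 2) :
    SmoothOn U (fun t x => f t x i) :=
  contDiffOn_euclidean.1 hf i

lemma SmoothOn.dtime_congr {U : Set (ℝ × ℝ)} (hU : IsOpen U) {f g : ℝ → ℝ → ℝ}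
    (h : ∀ t x, (t, x) ∈ U → f t x = g t x) {t x : ℝ} (hp : (t, x) ∈ U) :
    _root_.dtime f t x = _root_.dtime g t x := by
  have : ∀ᶠ u in nhds t, (u, x) ∈ U :=
    (Continuous.prodMk_left x).continuousAt.eventually (hU.mem_nhds hp)
  refine Filter.EventuallyEq.deriv_eq ?_
  filter_upwards [this] with u hu using h u x hu

/-- The set of `(t, x)` at which the curve `γ t` is regular. -/
def regSet (γ : ℝ → ℝ → E2) : Set (ℝ × ℝ) := {p | deriv (γ p.1) p.2 ≠ 0}

variable {γ : ℝ → ℝ → E2}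

lemma smoothOn_deriv (hγ : SmoothOn univ γ) : SmoothOn univ (fun t x => deriv (γ t) x) :=
  hγ.dspace isOpen_univ

lemma isOpen_regSet (hγ : SmoothOn univ γ) : IsOpen (regSet γ) :=
  isOpen_ne.preimage (continuousOn_univ.1 (smoothOn_deriv hγ).continuousOn)

lemma SmoothOn.mono {E : Type*} [NormedAddCommGroup E] [NormedSpace ℝ E] {U V : Set (ℝ × ℝ)}
    {f : ℝ → ℝ → E} (hf : SmoothOn V f) (h : U ⊆ V) : SmoothOn U f := ContDiffOn.mono hf h

lemma smoothOn_speed (hγ : SmoothOn univ γ) :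
    SmoothOn (regSet γ) (fun t x => ‖deriv (γ t) x‖) :=
  ContDiffOn.norm ℝ ((smoothOn_deriv hγ).mono (subset_univ _)) fun _ hp => hp

lemma smoothOn_inv_speed (hγ : SmoothOn univ γ) :
    SmoothOn (regSet γ) (fun t x => ‖deriv (γ t) x‖⁻¹) :=
  (smoothOn_speed hγ).inv fun _ hp => norm_ne_zero_iff.2 hp

lemma smoothOn_utangent (hγ : SmoothOn univ γ) :
    SmoothOn (regSet γ) (fun t x => utangent (γ t) x) :=
  ContDiffOn.smul (smoothOn_inv_speed hγ) ((smoothOn_deriv hγ).mono (subset_univ _))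

lemma smoothOn_aderiv (hγ : SmoothOn univ γ) {f : ℝ → ℝ → ℝ} (hf : SmoothOn (regSet γ) f) :
    SmoothOn (regSet γ) (fun t x => aderiv (γ t) (f t) x) :=
  (smoothOn_inv_speed hγ).mul (hf.dspace (isOpen_regSet hγ))

lemma speed_mul_aderiv (f : ℝ → ℝ → ℝ) {t x : ℝ} (hp : (t, x) ∈ regSet γ) :
    ‖deriv (γ t) x‖ * aderiv (γ t) (f t) x = dspace f t x :=
  mul_inv_cancel_left₀ (norm_ne_zero_iff.2 hp) _

lemma hasDerivAt_aderiv (hγ : SmoothOn univ γ) {f : ℝ → ℝ → ℝ}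
    (hf : SmoothOn (regSet γ) f) {t x : ℝ} (hp : (t, x) ∈ regSet γ) :
    HasDerivAt (f t) (‖deriv (γ t) x‖ * aderiv (γ t) (f t) x) x := by
  rw [speed_mul_aderiv f hp]
  exact hf.hasDerivAt_space (isOpen_regSet hγ) hp

lemma rot_zero (v : E2) : rot v 0 = -(v 1) := rfl

lemma rot_one (v : E2) : rot v 1 = v 0 := rfl

lemma dspace_component (hγ : SmoothOn univ γ) (i : Fin 2) {t x : ℝ} (hp : (t, x) ∈ regSet γ) :
    dspace (fun t x => γ t x i) t x = ‖deriv (γ t) x‖ * utangent (γ t) x i := by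
  have h := (hγ.hasDerivAt_space isOpen_univ (mem_univ (t, x))).e2_apply i
  rw [dspace, h.deriv]
  exact (mul_inv_cancel_left₀ (norm_ne_zero_iff.2 hp) _).symm

lemma utangent_sq_add_sq {t x : ℝ} (hp : (t, x) ∈ regSet γ) :
    utangent (γ t) x 0 ^ 2 + utangent (γ t) x 1 ^ 2 = 1 := by
  have h : ‖utangent (γ t) x‖ = 1 := by
    rw [utangent, aderivVec, norm_smul, norm_inv, norm_norm,
      inv_mul_cancel₀ (norm_ne_zero_iff.2 hp)]
  have := EuclideanSpace.real_norm_sq_eq (utangent (γ t) x)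
  rw [h, Fin.sum_univ_two] at this
  linarith

lemma curv_eq (hγ : SmoothOn univ γ) {t x : ℝ} (hp : (t, x) ∈ regSet γ) :
    curv (γ t) x = ‖deriv (γ t) x‖⁻¹ *
      (utangent (γ t) x 0 * dspace (fun t x => utangent (γ t) x 1) t x -
        utangent (γ t) x 1 * dspace (fun t x => utangent (γ t) x 0) t x) := by
  have h := (smoothOn_utangent hγ).hasDerivAt_space (isOpen_regSet hγ) hp
  have h0 : dspace (fun t x => utangent (γ t) x 0) t x =
    dspace (fun t x => utangent (γ t) x) t x 0 := (h.e2_apply 0).deriv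
  have h1 : dspace (fun t x => utangent (γ t) x 1) t x =
    dspace (fun t x => utangent (γ t) x) t x 1 := (h.e2_apply 1).deriv
  rw [h0, h1]
  simp only [curv, unormal, aderivVec, PiLp.inner_apply, Fin.sum_univ_two, rot_zero, rot_one,
    PiLp.smul_apply, smul_eq_mul, RCLike.inner_apply, conj_trivial, dspace]
  ring

lemma smoothOn_curv (hγ : SmoothOn univ γ) : SmoothOn (regSet γ) (fun t x => curv (γ t) x) := by
  have hτ := smoothOn_utangent hγ
  have hU := isOpen_regSet hγ
  exact ContDiffOn.congr ((smoothOn_inv_speed hγ).mul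
    (((hτ.e2_apply 0).mul ((hτ.e2_apply 1).dspace hU)).sub
      ((hτ.e2_apply 1).mul ((hτ.e2_apply 0).dspace hU)))) fun p hp => curv_eq hγ hp

lemma smoothOn_kds (hγ : SmoothOn univ γ) : ∀ j, SmoothOn (regSet γ) (fun t x => kds (γ t) j x)
  | 0 => smoothOn_curv hγ
  | j + 1 => smoothOn_aderiv hγ (smoothOn_kds hγ j)

lemma smoothOn_speedF (hγ : SmoothOn univ γ) :
    SmoothOn (regSet γ) (fun t x => speedF (γ t) x) :=
  (((smoothOn_kds hγ 4).add (((smoothOn_curv hγ).pow 2).mul (smoothOn_kds hγ 2)))).sub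
    (((smoothOn_curv hγ).const_mul (1 / 2)).mul ((smoothOn_kds hγ 1).pow 2))

/-- The time slice `t` consists of a regular curve that moves with normal speed `speedF`. -/
structure FlowSlice (γ : ℝ → ℝ → E2) (t : ℝ) : Prop where
  smooth : SmoothOn univ γ
  regular : ∀ x ∈ Icc (-1:ℝ) 1, (t, x) ∈ regSet γ
  flow : ∀ x ∈ Icc (-1:ℝ) 1,
    HasDerivAt (fun u => γ u x) (speedF (γ t) x • unormal (γ t) x) t

namespace FlowSlice

variable {t x : ℝ}

lemma frenet (hγ : SmoothOn univ γ) (hp : (t, x) ∈ regSet γ) :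
    dspace (fun t x => utangent (γ t) x 0) t x =
        -(‖deriv (γ t) x‖ * curv (γ t) x * utangent (γ t) x 1) ∧
      dspace (fun t x => utangent (γ t) x 1) t x =
        ‖deriv (γ t) x‖ * curv (γ t) x * utangent (γ t) x 0 := by
  have hτ := smoothOn_utangent hγ
  have hU := isOpen_regSet hγ
  have hw : ‖deriv (γ t) x‖ ≠ 0 := norm_ne_zero_iff.2 hp
  have hk := curv_eq hγ hp
  rw [inv_mul_eq_div, eq_div_iff hw] at hk
  have h0 := (hτ.e2_apply 0).hasDerivAt_space hU hp
  have h1 := (hτ.e2_apply 1).hasDerivAt_space hU hp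
  have hone := utangent_sq_add_sq hp
  have hd : 2 * utangent (γ t) x 0 * dspace (fun t x => utangent (γ t) x 0) t x +
      2 * utangent (γ t) x 1 * dspace (fun t x => utangent (γ t) x 1) t x = 0 := by
    have h := (h0.pow 2).add (h1.pow 2)
    have hc : ∀ᶠ y in nhds x, (t, y) ∈ regSet γ :=
      (Continuous.prodMk_right t).continuousAt.eventually (hU.mem_nhds hp)
    have h' := h.congr_of_eventuallyEq (f₁ := fun _ => (1 : ℝ)) (by
      filter_upwards [hc] with y hy using (utangent_sq_add_sq hy).symm)
    have := h'.unique (hasDerivAt_const x 1)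
    simpa using this
  constructor
  · linear_combination utangent (γ t) x 1 * hk -
      dspace (fun t x => utangent (γ t) x 0) t x * hone + utangent (γ t) x 0 / 2 * hd
  · linear_combination -utangent (γ t) x 0 * hk -
      dspace (fun t x => utangent (γ t) x 1) t x * hone + utangent (γ t) x 1 / 2 * hd

lemma time_tangent (hγ : SmoothOn univ γ) (hp : (t, x) ∈ regSet γ) :
    2 * utangent (γ t) x 0 * dtime (fun t x => utangent (γ t) x 0) t x +
      2 * utangent (γ t) x 1 * dtime (fun t x => utangent (γ t) x 1) t x = 0 := by
  have hτ := smoothOn_utangent hγ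
  have hU := isOpen_regSet hγ
  have h := (((hτ.e2_apply 0).hasDerivAt_time hU hp).pow 2).add
    (((hτ.e2_apply 1).hasDerivAt_time hU hp).pow 2)
  have hc : ∀ᶠ u in nhds t, (u, x) ∈ regSet γ :=
    (Continuous.prodMk_left x).continuousAt.eventually (hU.mem_nhds hp)
  have h' := h.congr_of_eventuallyEq (f₁ := fun _ => (1 : ℝ)) (by
    filter_upwards [hc] with y hy using (utangent_sq_add_sq hy).symm)
  have := h'.unique (hasDerivAt_const t 1)
  simpa using this

lemma dtime_component_zero (S : FlowSlice γ t) (hx : x ∈ Icc (-1:ℝ) 1) :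
    dtime (fun t x => γ t x 0) t x = -(speedF (γ t) x * utangent (γ t) x 1) := by
  rw [dtime, ((S.flow x hx).e2_apply 0).deriv, PiLp.smul_apply, unormal, rot_zero, smul_eq_mul,
    mul_neg]

lemma dtime_component_one (S : FlowSlice γ t) (hx : x ∈ Icc (-1:ℝ) 1) :
    dtime (fun t x => γ t x 1) t x = speedF (γ t) x * utangent (γ t) x 0 := by
  rw [dtime, ((S.flow x hx).e2_apply 1).deriv, PiLp.smul_apply, unormal, rot_one, smul_eq_mul]

lemma hasDerivAt_slice (S : FlowSlice γ t) {f : ℝ → ℝ → ℝ} (hf : SmoothOn (regSet γ) f)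
    (hx : x ∈ Icc (-1:ℝ) 1) :
    HasDerivAt (f t) (‖deriv (γ t) x‖ * aderiv (γ t) (f t) x) x :=
  hasDerivAt_aderiv S.smooth hf (S.regular x hx)

/-- If `∂ₜ f = g` along the slice then `∂ₜ ∂ₓ f = ∂ₓ g` along the slice. -/
lemma dtime_dspace_eq (S : FlowSlice γ t) {f : ℝ → ℝ → ℝ} {g : ℝ → ℝ} {g' : ℝ}
    (hf : SmoothOn (regSet γ) f) (h : ∀ y ∈ Icc (-1:ℝ) 1, dtime f t y = g y)
    (hx : x ∈ Icc (-1:ℝ) 1) (hg : HasDerivAt g g' x) : dtime (dspace f) t x = g' := by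
  have hU := isOpen_regSet S.smooth
  rw [hf.dtime_dspace hU (S.regular x hx)]
  exact HasDerivAt.unique_of_eqOn_Icc (by norm_num) h hx
    ((hf.dtime hU).hasDerivAt_space hU (S.regular x hx)) hg

/-- Differentiating `w f = g` in time. -/
lemma dtime_mul_eq (S : FlowSlice γ t) {f g h : ℝ → ℝ → ℝ} (hf : SmoothOn (regSet γ) f)
    (hg : SmoothOn (regSet γ) g)
    (heq : ∀ t x, (t, x) ∈ regSet γ → h t x = g t x * f t x) (hx : x ∈ Icc (-1:ℝ) 1) :
    dtime h t x = dtime g t x * f t x + g t x * dtime f t x := by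
  have hU := isOpen_regSet S.smooth
  have hp := S.regular x hx
  rw [SmoothOn.dtime_congr hU (g := fun t x => g t x * f t x) heq hp]
  exact ((hg.hasDerivAt_time hU hp).mul (hf.hasDerivAt_time hU hp)).deriv

/-- Time derivatives of the length element and of the unit tangent. -/
lemma dtime_frame (S : FlowSlice γ t) (hx : x ∈ Icc (-1:ℝ) 1) :
    dtime (fun t x => ‖deriv (γ t) x‖) t x =
        -(curv (γ t) x * speedF (γ t) x * ‖deriv (γ t) x‖) ∧
      dtime (fun t x => utangent (γ t) x 0) t x =
        -(aderiv (γ t) (speedF (γ t)) x * utangent (γ t) x 1) ∧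
      dtime (fun t x => utangent (γ t) x 1) t x =
        aderiv (γ t) (speedF (γ t)) x * utangent (γ t) x 0 := by
  have hγ := S.smooth
  have hU := isOpen_regSet hγ
  have hp := S.regular x hx
  have hτ := smoothOn_utangent hγ
  have hw : ‖deriv (γ t) x‖ ≠ 0 := norm_ne_zero_iff.2 hp
  have hF := S.hasDerivAt_slice (smoothOn_speedF hγ) hx
  have hγU : SmoothOn (regSet γ) γ := hγ.mono (subset_univ _)
  obtain ⟨f0, f1⟩ := frenet hγ hp
  have hone := utangent_sq_add_sq hp
  have htan := time_tangent hγ hp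
  have e0 := S.dtime_dspace_eq (hγU.e2_apply 0) (fun y hy => S.dtime_component_zero hy) hx
    (hF.mul ((hτ.e2_apply 1).hasDerivAt_space hU hp)).neg
  have e1 := S.dtime_dspace_eq (hγU.e2_apply 1) (fun y hy => S.dtime_component_one hy) hx
    (hF.mul ((hτ.e2_apply 0).hasDerivAt_space hU hp))
  rw [S.dtime_mul_eq (hτ.e2_apply 0) (smoothOn_speed hγ)
    (fun t x h => dspace_component hγ 0 h) hx, f1] at e0
  rw [S.dtime_mul_eq (hτ.e2_apply 1) (smoothOn_speed hγ)
    (fun t x h => dspace_component hγ 1 h) hx, f0] at e1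
  set w := ‖deriv (γ t) x‖
  set c := utangent (γ t) x 0
  set s := utangent (γ t) x 1
  set F' := aderiv (γ t) (speedF (γ t)) x
  have hwt : dtime (fun t x => ‖deriv (γ t) x‖) t x =
      -(curv (γ t) x * speedF (γ t) x * w) := by
    linear_combination c * e0 + s * e1 - w / 2 * htan -
      (dtime (fun t x => ‖deriv (γ t) x‖) t x + curv (γ t) x * speedF (γ t) x * w) * hone
  refine ⟨hwt, mul_left_cancel₀ hw ?_, mul_left_cancel₀ hw ?_⟩
  · linear_combination e0 - c * hwt
  · linear_combination e1 - s * hwt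

/-- Commutator of `∂ₜ` and `∂ₛ`. -/
lemma dtime_aderiv (S : FlowSlice γ t) {f g : ℝ → ℝ → ℝ} (hf : SmoothOn (regSet γ) f)
    (hg : SmoothOn (regSet γ) g) (h : ∀ y ∈ Icc (-1:ℝ) 1, dtime f t y = g t y)
    (hx : x ∈ Icc (-1:ℝ) 1) :
    dtime (fun t x => aderiv (γ t) (f t) x) t x =
      aderiv (γ t) (g t) x + curv (γ t) x * speedF (γ t) x * aderiv (γ t) (f t) x := by
  have hγ := S.smooth
  have hw : ‖deriv (γ t) x‖ ≠ 0 := norm_ne_zero_iff.2 (S.regular x hx)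
  have e := S.dtime_dspace_eq hf h hx (S.hasDerivAt_slice hg hx)
  rw [S.dtime_mul_eq (smoothOn_aderiv hγ hf) (smoothOn_speed hγ)
    (fun t x h => (speed_mul_aderiv f h).symm) hx, (S.dtime_frame hx).1] at e
  refine mul_left_cancel₀ hw ?_
  linear_combination e

/-- Evolution of the curvature. -/
lemma dtime_curv (S : FlowSlice γ t) (hx : x ∈ Icc (-1:ℝ) 1) :
    dtime (fun t x => curv (γ t) x) t x =
      aderiv (γ t) (aderiv (γ t) (speedF (γ t))) x + curv (γ t) x ^ 2 * speedF (γ t) x := by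
  have hγ := S.smooth
  have hU := isOpen_regSet hγ
  have hp := S.regular x hx
  have hτ := smoothOn_utangent hγ
  have hc := hτ.e2_apply 0
  have hs := hτ.e2_apply 1
  have hw : ‖deriv (γ t) x‖ ≠ 0 := norm_ne_zero_iff.2 hp
  have hF1 : SmoothOn (regSet γ) fun t x => aderiv (γ t) (speedF (γ t)) x :=
    smoothOn_aderiv hγ (smoothOn_speedF hγ)
  have hψ := S.hasDerivAt_slice hF1 hx
  obtain ⟨wt, ct, st⟩ := S.dtime_frame hx
  obtain ⟨f0, f1⟩ := frenet hγ hp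
  have hone := utangent_sq_add_sq hp
  have ect := S.dtime_dspace_eq hc (fun y hy => (S.dtime_frame hy).2.1) hx
    (hψ.mul (hs.hasDerivAt_space hU hp)).neg
  have est := S.dtime_dspace_eq hs (fun y hy => (S.dtime_frame hy).2.2) hx
    (hψ.mul (hc.hasDerivAt_space hU hp))
  have hk : ∀ t x, (t, x) ∈ regSet γ → utangent (γ t) x 0 *
      dspace (fun t x => utangent (γ t) x 1) t x - utangent (γ t) x 1 *
      dspace (fun t x => utangent (γ t) x 0) t x = ‖deriv (γ t) x‖ * curv (γ t) x :=
    fun t x h => by rw [curv_eq hγ h, mul_inv_cancel_left₀ (norm_ne_zero_iff.2 h)]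
  have e1 := S.dtime_mul_eq (h := fun t x => utangent (γ t) x 0 *
      dspace (fun t x => utangent (γ t) x 1) t x - utangent (γ t) x 1 *
      dspace (fun t x => utangent (γ t) x 0) t x) (smoothOn_curv hγ) (smoothOn_speed hγ) hk hx
  have e2 := ((hc.hasDerivAt_time hU hp).mul ((hs.dspace hU).hasDerivAt_time hU hp)).sub
    ((hs.hasDerivAt_time hU hp).mul ((hc.dspace hU).hasDerivAt_time hU hp)) |>.deriv
  have e := e1.symm.trans e2
  rw [wt, ct, st, ect, est, f0, f1] at e
  refine mul_left_cancel₀ hw ?_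
  linear_combination e + ‖deriv (γ t) x‖ *
    aderiv (γ t) (aderiv (γ t) (speedF (γ t))) x * hone

end FlowSlice
end CurveFamily

section EnergyIdentity

variable {γ : ℝ → ℝ → E2} {t : ℝ}

namespace FlowSlice

lemma wint_mul_aderiv (S : FlowSlice γ t) {f g : ℝ → ℝ → ℝ} (hf : SmoothOn (regSet γ) f)
    (hg : SmoothOn (regSet γ) g) (hl : f t (-1) * g t (-1) = 0) (hr : f t 1 * g t 1 = 0) :
    wint (fun x => ‖deriv (γ t) x‖) (fun x => f t x * aderiv (γ t) (g t) x) =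
      -wint (fun x => ‖deriv (γ t) x‖) (fun x => aderiv (γ t) (f t) x * g t x) := by
  have hc : ∀ {h : ℝ → ℝ → ℝ}, SmoothOn (regSet γ) h → ContinuousOn (h t) (Icc (-1) 1) :=
    fun h => h.continuousOn_space S.regular
  rw [wint_mul_deriv (hc (smoothOn_speed S.smooth)) (fun x hx => S.hasDerivAt_slice hf hx)
    (fun x hx => S.hasDerivAt_slice hg hx) (hc (smoothOn_aderiv S.smooth hf))
    (hc (smoothOn_aderiv S.smooth hg)), hl, hr]
  ring

lemma aderiv_speedF (S : FlowSlice γ t) {x : ℝ} (hx : x ∈ Icc (-1:ℝ) 1) :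
    aderiv (γ t) (speedF (γ t)) x =
      kds (γ t) 5 x + kds (γ t) 0 x * kds (γ t) 1 x * kds (γ t) 2 x +
        kds (γ t) 0 x ^ 2 * kds (γ t) 3 x - 1 / 2 * kds (γ t) 1 x ^ 3 := by
  have hw : ‖deriv (γ t) x‖ ≠ 0 := norm_ne_zero_iff.2 (S.regular x hx)
  have hk : ∀ j, HasDerivAt (kds (γ t) j) (‖deriv (γ t) x‖ * kds (γ t) (j + 1) x) x :=
    fun j => S.hasDerivAt_slice (smoothOn_kds S.smooth j) hx
  have h := ((hk 4).add (((hk 0).pow 2).mul (hk 2))).sub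
    (((hk 0).const_mul (1 / 2)).mul ((hk 1).pow 2))
  have e := (S.hasDerivAt_slice (smoothOn_speedF S.smooth) hx).unique h
  refine mul_left_cancel₀ hw (e.trans ?_)
  simp only [Pi.pow_apply, Nat.reduceAdd, Nat.add_one_sub_one, pow_one, Nat.cast_ofNat]
  ring

/-- The energy identity. -/
lemma hasDerivAt_knorm2 (S : FlowSlice γ t)
    (hF : ∀ x ∈ ({-1, 1} : Set ℝ), aderiv (γ t) (speedF (γ t)) x = 0)
    (hk₁ : ∀ x ∈ ({-1, 1} : Set ℝ), dtime (fun t x => kds (γ t) 1 x) t x = 0)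
    (hk₃ : ∀ x ∈ ({-1, 1} : Set ℝ), kds (γ t) 3 x = 0) :
    HasDerivAt (fun u => knorm2 (γ u) 2)
      (wint (fun x => ‖deriv (γ t) x‖) (rateDensity (kds (γ t)))) t := by
  have hγ := S.smooth
  have hU := isOpen_regSet hγ
  have hc : ∀ {h : ℝ → ℝ → ℝ}, SmoothOn (regSet γ) h → ContinuousOn (h t) (Icc (-1) 1) :=
    fun h => h.continuousOn_space S.regular
  have hk := smoothOn_kds hγ
  have hw := smoothOn_speed hγ
  have sF := smoothOn_speedF hγ
  have sF₁ : SmoothOn (regSet γ) fun t x => aderiv (γ t) (speedF (γ t)) x :=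
    smoothOn_aderiv hγ sF
  have sF₂ : SmoothOn (regSet γ) fun t x => aderiv (γ t) (aderiv (γ t) (speedF (γ t))) x :=
    smoothOn_aderiv hγ sF₁
  set G₀ : ℝ → ℝ → ℝ := fun t x =>
    aderiv (γ t) (aderiv (γ t) (speedF (γ t))) x + curv (γ t) x ^ 2 * speedF (γ t) x with hG₀
  have s₀ : SmoothOn (regSet γ) G₀ := sF₂.add (((smoothOn_curv hγ).pow 2).mul sF)
  set G₁ : ℝ → ℝ → ℝ := fun t x =>
    aderiv (γ t) (G₀ t) x + curv (γ t) x * speedF (γ t) x * kds (γ t) 1 x with hG₁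
  have s₁ : SmoothOn (regSet γ) G₁ :=
    (smoothOn_aderiv hγ s₀).add (((smoothOn_curv hγ).mul sF).mul (hk 1))
  have e₁ : ∀ x ∈ Icc (-1:ℝ) 1, dtime (fun t x => kds (γ t) 1 x) t x = G₁ t x :=
    fun x hx => S.dtime_aderiv (hk 0) s₀ (fun y hy => S.dtime_curv hy) hx
  have e₂ : ∀ x ∈ Icc (-1:ℝ) 1, dtime (fun t x => kds (γ t) 2 x) t x =
      aderiv (γ t) (G₁ t) x + curv (γ t) x * speedF (γ t) x * kds (γ t) 2 x :=
    fun x hx => S.dtime_aderiv (hk 1) s₁ e₁ hx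
  have hb : ∀ x ∈ ({-1, 1} : Set ℝ), x ∈ Icc (-1:ℝ) 1 := by
    rintro x (rfl | rfl) <;> norm_num
  have hG₁b : ∀ x ∈ ({-1, 1} : Set ℝ), G₁ t x = 0 := fun x hx =>
    (e₁ x (hb x hx)).symm.trans (hk₁ x hx)
  have hl : (-1:ℝ) ∈ ({-1, 1} : Set ℝ) := by simp
  have hr : (1:ℝ) ∈ ({-1, 1} : Set ℝ) := by simp
  have i₁ := S.wint_mul_aderiv (hk 2) s₁ (by rw [hG₁b _ hl, mul_zero])
    (by rw [hG₁b _ hr, mul_zero])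
  have i₂ := S.wint_mul_aderiv (hk 3) s₀ (by rw [hk₃ _ hl, zero_mul])
    (by rw [hk₃ _ hr, zero_mul])
  have i₃ := S.wint_mul_aderiv (hk 4) sF₁ (by rw [hF _ hl, mul_zero])
    (by rw [hF _ hr, mul_zero])
  have main := SmoothOn.hasDerivAt_integral (((hk 2).pow 2).mul hw) hU (t := t)
    (by norm_num : (-1:ℝ) ≤ 1) S.regular
  refine main.congr_deriv ?_
  set w : ℝ → ℝ := fun x => ‖deriv (γ t) x‖
  have hcw : ContinuousOn w (Icc (-1) 1) := hc hw
  have d : (∫ x in (-1:ℝ)..1, dtime (fun t x => kds (γ t) 2 x ^ 2 * ‖deriv (γ t) x‖) t x) =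
      wint w fun x => 2 * (kds (γ t) 2 x * aderiv (γ t) (G₁ t) x) +
        curv (γ t) x * speedF (γ t) x * kds (γ t) 2 x ^ 2 := by
    refine intervalIntegral.integral_congr fun x hx => ?_
    rw [uIcc_of_le (by norm_num)] at hx
    have hp := S.regular x hx
    have h := ((((hk 2).hasDerivAt_time hU hp).pow 2).mul (hw.hasDerivAt_time hU hp)).deriv
    refine h.trans ?_
    rw [e₂ x hx, (S.dtime_frame hx).1]
    simp only [w, Pi.pow_apply, Nat.add_one_sub_one, pow_one, Nat.cast_ofNat]
    ring
  have ck : ∀ j, ContinuousOn (kds (γ t) j) (Icc (-1) 1) := fun j => hc (hk j)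
  have cc : ContinuousOn (curv (γ t)) (Icc (-1) 1) := ck 0
  have cF : ContinuousOn (speedF (γ t)) (Icc (-1) 1) := hc sF
  have cF₁ : ContinuousOn (aderiv (γ t) (speedF (γ t))) (Icc (-1) 1) := hc sF₁
  have cF₂ : ContinuousOn (aderiv (γ t) (aderiv (γ t) (speedF (γ t)))) (Icc (-1) 1) := hc sF₂
  have cG₀ : ContinuousOn (aderiv (γ t) (G₀ t)) (Icc (-1) 1) := hc (smoothOn_aderiv hγ s₀)
  have cG₁ : ContinuousOn (aderiv (γ t) (G₁ t)) (Icc (-1) 1) := hc (smoothOn_aderiv hγ s₁)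
  have j₁ : wint w (fun x => aderiv (γ t) (kds (γ t) 2) x * G₁ t x) =
      wint w (fun x => kds (γ t) 3 x * aderiv (γ t) (G₀ t) x) +
        wint w (fun x => curv (γ t) x * speedF (γ t) x * kds (γ t) 1 x * kds (γ t) 3 x) := by
    rw [← wint_add hcw (by fun_prop) (by fun_prop)]
    refine wint_congr fun x _ => ?_
    change kds (γ t) 3 x * G₁ t x = _
    simp only [hG₁]
    ring
  have j₂ : wint w (fun x => aderiv (γ t) (kds (γ t) 3) x * G₀ t x) =
      wint w (fun x => kds (γ t) 4 x * aderiv (γ t) (aderiv (γ t) (speedF (γ t))) x) +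
        wint w (fun x => curv (γ t) x ^ 2 * speedF (γ t) x * kds (γ t) 4 x) := by
    rw [← wint_add hcw (by fun_prop) (by fun_prop)]
    refine wint_congr fun x _ => ?_
    change kds (γ t) 4 x * G₀ t x = _
    simp only [hG₀]
    ring
  have j₃ : wint w (rateDensity (kds (γ t))) =
      -2 * wint w (fun x => aderiv (γ t) (kds (γ t) 4) x * aderiv (γ t) (speedF (γ t)) x) +
      (2 * wint w (fun x => curv (γ t) x ^ 2 * speedF (γ t) x * kds (γ t) 4 x) +
      (-2 * wint w (fun x => curv (γ t) x * speedF (γ t) x * kds (γ t) 1 x * kds (γ t) 3 x) +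
      wint w (fun x => curv (γ t) x * speedF (γ t) x * kds (γ t) 2 x ^ 2))) := by
    have c5 : ContinuousOn (aderiv (γ t) (kds (γ t) 4)) (Icc (-1) 1) := ck 5
    have c0 := ck 0
    have c1 := ck 1
    have c2 := ck 2
    have c3 := ck 3
    have c4 := ck 4
    simp only [← wint_const_mul]
    rw [← wint_add hcw (by fun_prop) (by fun_prop), ← wint_add hcw (by fun_prop) (by fun_prop),
      ← wint_add hcw (by fun_prop) (by fun_prop)]
    refine wint_congr fun x hx => ?_
    change _ = -2 * (kds (γ t) 5 x * aderiv (γ t) (speedF (γ t)) x) + _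
    rw [S.aderiv_speedF hx]
    simp only [speedF, rateDensity, kds, aderivIter]
    ring
  rw [d, wint_add hcw (by fun_prop) (by fun_prop), wint_const_mul, j₃]
  linear_combination 2 * i₁ - 2 * j₁ - 2 * i₂ + 2 * j₂ + 2 * i₃

end FlowSlice
end EnergyIdentity

section Decay

lemma inTime.mono {T : ℝ≥0∞} {s t : ℝ} (ht : inTime T t) (hs : 0 ≤ s) (hst : s ≤ t) :
    inTime T s :=
  ⟨hs, (ENNReal.ofReal_le_ofReal hst).trans_lt ht.2⟩

lemma inTime.deriv_eq_zero {T : ℝ≥0∞} {t f' : ℝ} {f : ℝ → ℝ} (ht : inTime T t)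
    (hf : HasDerivAt f f' t) (h0 : ∀ u, inTime T u → f u = 0) : f' = 0 := by
  have hT : ∀ᶠ u in nhdsWithin t (Ici t), ENNReal.ofReal u < T :=
    nhdsWithin_le_nhds ((ENNReal.continuous_ofReal.tendsto t).eventually (gt_mem_nhds ht.2))
  refine (uniqueDiffOn_Ici t t self_mem_Ici).eq_deriv _ hf.hasDerivWithinAt
    ((hasDerivWithinAt_const t (Ici t) (0:ℝ)).congr_of_eventuallyEq ?_ (h0 t ht))
  filter_upwards [hT, self_mem_nhdsWithin] with u hu htu using h0 u ⟨ht.1.trans htu, hu⟩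

variable {T : ℝ≥0∞} {Φ : SixthFlow T} {e t : ℝ}

lemma SixthFlow.flowSlice (Φ : SixthFlow T) (ht : inTime T t) : FlowSlice Φ.γ t where
  smooth := Φ.smooth.contDiffOn
  regular _ hx := Φ.regular ht hx
  flow x hx := by
    have h := SmoothOn.hasDerivAt_time (U := univ) (f := Φ.γ) Φ.smooth.contDiffOn isOpen_univ
      (mem_univ (t, x))
    exact h.congr_deriv ((uniqueDiffOn_Ici (0:ℝ) t ht.1).eq_deriv _ h.hasDerivWithinAt
      (Φ.flow ht hx))

lemma BC.hasDerivAt_knorm2 (hB : BC Φ e) (ht : inTime T t) :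
    HasDerivAt (fun u => knorm2 (Φ.γ u) 2)
      (wint (fun x => ‖deriv (Φ.γ t) x‖) (rateDensity (kds (Φ.γ t)))) t := by
  have S := Φ.flowSlice ht
  have hU := isOpen_regSet S.smooth
  have hb : ∀ x ∈ ({-1, 1} : Set ℝ), x ∈ Icc (-1:ℝ) 1 := by
    rintro x (rfl | rfl) <;> norm_num
  refine S.hasDerivAt_knorm2 (fun x hx => ?_) (fun x hx => ?_) ?_
  · have hp := S.regular x (hb x hx)
    have hs : ∀ u, inTime T u → utangent (Φ.γ u) x 1 = 0 := fun u hu => by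
      rcases hx with rfl | rfl
      · exact neg_eq_zero.1 (hB.neumann hu).1
      · exact neg_eq_zero.1 (hB.neumann hu).2
    have h := ht.deriv_eq_zero
      (((smoothOn_utangent S.smooth).e2_apply 1).hasDerivAt_time hU hp) hs
    rw [(S.dtime_frame (hb x hx)).2.2] at h
    refine (mul_eq_zero.1 h).resolve_right fun h0 => ?_
    have := utangent_sq_add_sq hp
    rw [h0, hs t ht] at this
    norm_num at this
  · refine ht.deriv_eq_zero
      ((smoothOn_kds S.smooth 1).hasDerivAt_time hU (S.regular x (hb x hx))) fun u hu => ?_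
    rcases hx with rfl | rfl
    exacts [(hB.noflux hu).1, (hB.noflux hu).2]
  · rintro x (rfl | rfl)
    exacts [(hB.noflux3 ht).1, (hB.noflux3 ht).2]

lemma FlowSlice.clen_pos {γ : ℝ → ℝ → E2} (S : FlowSlice γ t) : 0 < clen (γ t) := by
  refine intervalIntegral.intervalIntegral_pos_of_pos_on ?_ (fun x hx => ?_) (by norm_num)
  · exact ContinuousOn.intervalIntegrable_unit
      (continuousOn_const.mul ((smoothOn_speed S.smooth).continuousOn_space S.regular))
  · rw [one_mul]
    exact norm_pos_iff.2 (S.regular x (Ioo_subset_Icc_self hx))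

lemma smallness_constant_le : (√1717 - 37) / 174 * π ^ 3 ≤ 4 / 5 := by
  have h1 : √1717 ≤ 41.44 := Real.sqrt_le_iff.2 ⟨by norm_num, by norm_num⟩
  have h2 : π ^ 3 ≤ 3.15 ^ 3 := pow_le_pow_left₀ pi_pos.le pi_lt_d2.le 3
  calc (√1717 - 37) / 174 * π ^ 3 ≤ (41.44 - 37) / 174 * 3.15 ^ 3 := by gcongr
    _ ≤ 4 / 5 := by norm_num

lemma BC.pow_mul_rate_le (hB : BC Φ e) (ht : inTime T t) (h0 : totalK (Φ.γ t) = 0)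
    (hA : knorm2 (Φ.γ t) 1 * clen (Φ.γ t) ^ 3 ≤ 4 / 5) :
    clen (Φ.γ t) ^ 6 * wint (fun x => ‖deriv (Φ.γ t) x‖) (rateDensity (kds (Φ.γ t))) ≤
      -knorm2 (Φ.γ t) 2 :=
  have S := Φ.flowSlice ht
  pow_mul_wint_rateDensity_le S.clen_pos
    ((smoothOn_speed S.smooth).continuousOn_space S.regular) (fun _ _ => norm_nonneg _) rfl
    (fun j _ hx => S.hasDerivAt_slice (smoothOn_kds S.smooth j) hx)
    (hB.noflux ht).1 (hB.noflux ht).2 (hB.noflux3 ht).1 (hB.noflux3 ht).2 h0 hA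

lemma knorm2_nonneg (γ : ℝ → E2) (j : ℕ) : 0 ≤ knorm2 γ j :=
  wint_nonneg (fun _ _ => norm_nonneg _) fun _ _ => sq_nonneg _

/-- Exponential decay from a differential inequality. -/
lemma le_mul_exp_of_hasDerivAt {f f' : ℝ → ℝ} {δ : ℝ} (ht : 0 ≤ t)
    (hf : ∀ u ∈ Icc 0 t, HasDerivAt f (f' u) u) (hle : ∀ u ∈ Icc 0 t, f' u ≤ -δ * f u) :
    f t ≤ f 0 * Real.exp (-δ * t) := by
  have hd : ∀ u ∈ Icc 0 t, HasDerivAt (fun u => Real.exp (δ * u) * f u)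
      (Real.exp (δ * u) * (δ * f u + f' u)) u := fun u hu => by
    refine ((((hasDerivAt_id u).const_mul δ).exp).mul (hf u hu)).congr_deriv ?_
    simp only [id]
    ring
  have hanti : AntitoneOn (fun u => Real.exp (δ * u) * f u) (Icc 0 t) := by
    refine antitoneOn_of_hasDerivWithinAt_nonpos (convex_Icc 0 t)
      (fun u hu => (hd u hu).continuousAt.continuousWithinAt)
      (fun u hu => (hd u (interior_subset hu)).hasDerivWithinAt) fun u hu => ?_
    exact mul_nonpos_of_nonneg_of_nonpos (Real.exp_pos _).le
      (by linarith [hle u (interior_subset hu)])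
  have h := hanti (left_mem_Icc.2 ht) (right_mem_Icc.2 ht) ht
  simp only [mul_zero, Real.exp_zero, one_mul] at h
  rwa [neg_mul, Real.exp_neg, ← div_eq_mul_inv, le_div_iff₀ (Real.exp_pos _), mul_comm]

end Decay

/-- **Exponential decay of `‖k_{ss}‖₂²`.**  Suppose that under the flow `ω(t) = 0`,
`L(t) ≤ L₀` and `‖k_s(·,t)‖₂² L(t)³ ≤ ((√1717 - 37)/174) π³ - δ₀` for all `t ∈ [0,T)`,
for some `δ₀ > 0` and `L₀ = L(0)`.  Then there exists `δ > 0`, depending only on `δ₀` and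
`L₀`, such that `(d/dt)‖k_{ss}‖₂² ≤ -δ ‖k_{ss}‖₂²` and hence
`‖k_{ss}(·,t)‖₂² ≤ ‖k_{ss}(·,0)‖₂² e^{-δ t}` for all `t ∈ [0,T)`. -/
theorem kss_exponential_decay (δ₀ L₀ : ℝ) (hδ₀ : 0 < δ₀) :
    ∃ δ : ℝ, 0 < δ ∧
      ∀ {T : ℝ≥0∞} (Φ : SixthFlow T) (e : ℝ), BC Φ e → clen (Φ.γ 0) = L₀ →
        (∀ t : ℝ, inTime T t →
          1 / (2 * π) * totalK (Φ.γ t) = 0 ∧ clen (Φ.γ t) ≤ L₀ ∧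
          knorm2 (Φ.γ t) 1 * (clen (Φ.γ t)) ^ 3
            ≤ (Real.sqrt 1717 - 37) / 174 * π ^ 3 - δ₀) →
        (∀ t : ℝ, inTime T t →
          ∃ D : ℝ, HasDerivWithinAt (fun u => knorm2 (Φ.γ u) 2) D (Ici 0) t ∧
            D ≤ -δ * knorm2 (Φ.γ t) 2) ∧
        (∀ t : ℝ, inTime T t →
          knorm2 (Φ.γ t) 2 ≤ knorm2 (Φ.γ 0) 2 * Real.exp (-δ * t)) := by
  refine ⟨1 / (L₀ ^ 6 + 1), by positivity, fun {T} Φ e hB _ hyp => ?_⟩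
  have hle : ∀ t, inTime T t →
      wint (fun x => ‖deriv (Φ.γ t) x‖) (rateDensity (kds (Φ.γ t))) ≤
        -(1 / (L₀ ^ 6 + 1)) * knorm2 (Φ.γ t) 2 := fun t ht => by
    obtain ⟨h0, hL, hA⟩ := hyp t ht
    have hK : totalK (Φ.γ t) = 0 := (mul_eq_zero.1 h0).resolve_left (by positivity)
    have hmain := hB.pow_mul_rate_le ht hK (by linarith [smallness_constant_le])
    have hpos := (Φ.flowSlice ht).clen_pos
    have hL6 : clen (Φ.γ t) ^ 6 ≤ L₀ ^ 6 := pow_le_pow_left₀ hpos.le hL 6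
    have hk := knorm2_nonneg (Φ.γ t) 2
    set D := wint (fun x => ‖deriv (Φ.γ t) x‖) (rateDensity (kds (Φ.γ t)))
    have hD : D ≤ 0 := by
      by_contra! h
      linarith [mul_pos (pow_pos hpos 6) h]
    have h1 : (L₀ ^ 6 + 1) * D ≤ clen (Φ.γ t) ^ 6 * D :=
      mul_le_mul_of_nonpos_right (by linarith) hD
    rw [neg_mul, one_div_mul_eq_div, ← neg_div, le_div_iff₀ (by positivity)]
    linarith
  exact ⟨fun t ht => ⟨_, (hB.hasDerivAt_knorm2 ht).hasDerivWithinAt, hle t ht⟩, fun t ht =>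
    le_mul_exp_of_hasDerivAt (f := fun u => knorm2 (Φ.γ u) 2) ht.1
      (fun u hu => hB.hasDerivAt_knorm2 (ht.mono hu.1 hu.2))
      fun u hu => hle u (ht.mono hu.1 hu.2)⟩
end
end

section
/- Suppose that under the flow one has ω(t) = 0, |e| ≤ L(t) ≤ L₀ for all t ∈ [0,T) with L₀ = L(0), and that there are constants K, δ > 0 with ‖k_{ss}(·,t)‖₂² ≤ K e^{−δ t} for all t. Then there is a constant C > 0, depending only on K, L₀ and |e|, such that ‖k(·,t)‖₂² + ‖k_s(·,t)‖₂² + ‖k(·,t)‖_∞² + ‖k_s(·,t)‖_∞² ≤ C e^{−δ t} for all t ∈ [0,T); in particular the curvature and its first arc length derivative decay pointwise exponentially to zero. -/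
noncomputable section

open Real Set MeasureTheory intervalIntegral
open scoped ENNReal RealInnerProductSpace

/-- `‖k_{s^j}(·,t)‖_∞`, the sup norm over `[-1,1]` of the `j`-th curvature derivative. -/
def ksup (γ : ℝ → E2) (j : ℕ) : ℝ := sSup ((fun x => |kds γ j x|) '' Icc (-1:ℝ) 1)

/-- If `f' = g v` on `[a, b]` with weight `v ≥ 0` and `f` vanishes somewhere on `[a, b]`, then
`f² ≤ (∫ v) (∫ g² v)` on `[a, b]`. -/
theorem sq_le_integral_mul_integral_of_hasDerivAt {a b : ℝ} {f g v : ℝ → ℝ}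
    (hg : ContinuousOn g (Icc a b)) (hv : ContinuousOn v (Icc a b))
    (hv0 : ∀ x ∈ Icc a b, 0 ≤ v x) (hf : ∀ x ∈ Icc a b, HasDerivAt f (g x * v x) x)
    {c x : ℝ} (hc : c ∈ Icc a b) (hfc : f c = 0) (hx : x ∈ Icc a b) :
    f x ^ 2 ≤ (∫ y in a..b, v y) * ∫ y in a..b, g y ^ 2 * v y := by
  have hab : a ≤ b := hc.1.trans hc.2
  have hint : ∀ {h : ℝ → ℝ}, ContinuousOn h (Icc a b) → IntervalIntegrable h volume a b :=
    fun hh => ContinuousOn.intervalIntegrable (by rwa [uIcc_of_le hab])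
  have hsub : uIcc c x ⊆ Icc a b := uIcc_subset_Icc hc hx
  have hgv : ContinuousOn (fun y => g y * v y) (Icc a b) := hg.mul hv
  have hagv : ContinuousOn (fun y => |g y * v y|) (Icc a b) := hgv.abs
  have hg2v : ContinuousOn (fun y => g y ^ 2 * v y) (Icc a b) := (hg.pow 2).mul hv
  have hftc : ∫ y in c..x, g y * v y = f x := by
    rw [integral_eq_sub_of_hasDerivAt (fun y hy => hf y (hsub hy))
      (hgv.mono hsub).intervalIntegrable, hfc, sub_zero]
  set N := ∫ y in a..b, |g y * v y|
  have hN0 : 0 ≤ N := integral_nonneg hab fun y _ => abs_nonneg _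
  have hfN : |f x| ≤ N := by
    have hioc : uIoc c x ⊆ uIoc a b := by
      rw [uIoc_of_le hab]
      exact Ioc_subset_Ioc (le_min hc.1 hx.1) (max_le hc.2 hx.2)
    calc |f x| ≤ |(∫ y in c..x, |g y * v y|)| := by
          rw [← hftc]
          simpa only [Real.norm_eq_abs] using
            norm_integral_le_abs_integral_norm (f := fun y => g y * v y) (a := c) (b := x)
      _ ≤ |N| := abs_integral_mono_interval hioc
          (Filter.Eventually.of_forall fun y => abs_nonneg _) (hint hagv)
      _ = N := abs_of_nonneg hN0
  have hquad : ∀ s : ℝ, 0 ≤ (∫ y in a..b, v y) * (s * s) + (2 * N) * s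
      + ∫ y in a..b, g y ^ 2 * v y := by
    intro s
    have heq : (∫ y in a..b, v y) * (s * s) + (2 * N) * s + ∫ y in a..b, g y ^ 2 * v y
        = ∫ y in a..b, (s * s * v y + 2 * s * |g y * v y| + g y ^ 2 * v y) := by
      rw [intervalIntegral.integral_add, intervalIntegral.integral_add,
        intervalIntegral.integral_const_mul, intervalIntegral.integral_const_mul]
      · ring
      · exact (hint hv).const_mul _
      · exact (hint hagv).const_mul _
      · exact ((hint hv).const_mul _).add ((hint hagv).const_mul _)
      · exact hint hg2v
    rw [heq]
    refine integral_nonneg hab fun y hy => ?_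
    have h1 : s * s * v y + 2 * s * |g y * v y| + g y ^ 2 * v y = (s + |g y|) ^ 2 * v y := by
      rw [abs_mul, abs_of_nonneg (hv0 y hy), ← sq_abs (g y)]
      ring
    rw [h1]
    exact mul_nonneg (sq_nonneg _) (hv0 y hy)
  have hdisc := discrim_le_zero hquad
  rw [discrim] at hdisc
  have hsq : f x ^ 2 ≤ N ^ 2 := by
    rw [← sq_abs (f x)]
    exact pow_le_pow_left₀ (abs_nonneg _) hfN 2
  linarith

/-- A weighted integral is bounded by the supremum times the total weight. -/
theorem integral_mul_le_of_le {a b M : ℝ} (hab : a ≤ b) {h v : ℝ → ℝ}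
    (hh : ContinuousOn h (Icc a b)) (hv : ContinuousOn v (Icc a b))
    (hv0 : ∀ x ∈ Icc a b, 0 ≤ v x) (hM : ∀ x ∈ Icc a b, h x ≤ M) :
    ∫ y in a..b, h y * v y ≤ M * ∫ y in a..b, v y := by
  rw [← intervalIntegral.integral_const_mul]
  refine integral_mono_on hab ?_ ?_ fun y hy => mul_le_mul_of_nonneg_right (hM y hy) (hv0 y hy)
  · exact ContinuousOn.intervalIntegrable (by rw [uIcc_of_le hab]; exact hh.mul hv)
  · exact ContinuousOn.intervalIntegrable (by rw [uIcc_of_le hab]; exact continuousOn_const.mul hv)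

theorem isOpen_deriv_ne_zero {γ : ℝ → E2} (hγ : ContDiff ℝ (⊤ : ℕ∞) γ) :
    IsOpen {x | deriv γ x ≠ 0} :=
  isOpen_ne_fun (hγ.continuous_deriv (by simp)) continuous_const

theorem contDiffOn_inv_norm_deriv {γ : ℝ → E2} (hγ : ContDiff ℝ (⊤ : ℕ∞) γ) :
    ContDiffOn ℝ (⊤ : ℕ∞) (fun x => (‖deriv γ x‖)⁻¹) {x | deriv γ x ≠ 0} := by
  have hd : ContDiffOn ℝ (⊤ : ℕ∞) (deriv γ) {x | deriv γ x ≠ 0} :=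
    hγ.contDiffOn.deriv_of_isOpen (isOpen_deriv_ne_zero hγ) (by simp)
  exact (hd.norm ℝ fun x hx => hx).inv fun x hx => norm_ne_zero_iff.2 hx

theorem contDiff_rot : ContDiff ℝ (⊤ : ℕ∞) rot := by
  rw [contDiff_euclidean]
  intro i
  fin_cases i
  · simpa [rot] using (contDiff_euclidean.1 (contDiff_id (E := E2)) 1).neg
  · simpa [rot] using contDiff_euclidean.1 (contDiff_id (E := E2)) 0

theorem contDiffOn_aderivVec {γ f : ℝ → E2} (hγ : ContDiff ℝ (⊤ : ℕ∞) γ)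
    (hf : ContDiffOn ℝ (⊤ : ℕ∞) f {x | deriv γ x ≠ 0}) :
    ContDiffOn ℝ (⊤ : ℕ∞) (aderivVec γ f) {x | deriv γ x ≠ 0} :=
  (contDiffOn_inv_norm_deriv hγ).smul (hf.deriv_of_isOpen (isOpen_deriv_ne_zero hγ) (by simp))

theorem contDiffOn_aderiv {γ : ℝ → E2} {f : ℝ → ℝ} (hγ : ContDiff ℝ (⊤ : ℕ∞) γ)
    (hf : ContDiffOn ℝ (⊤ : ℕ∞) f {x | deriv γ x ≠ 0}) :
    ContDiffOn ℝ (⊤ : ℕ∞) (aderiv γ f) {x | deriv γ x ≠ 0} :=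
  (contDiffOn_inv_norm_deriv hγ).mul (hf.deriv_of_isOpen (isOpen_deriv_ne_zero hγ) (by simp))

theorem contDiffOn_curv {γ : ℝ → E2} (hγ : ContDiff ℝ (⊤ : ℕ∞) γ) :
    ContDiffOn ℝ (⊤ : ℕ∞) (curv γ) {x | deriv γ x ≠ 0} := by
  have hτ : ContDiffOn ℝ (⊤ : ℕ∞) (utangent γ) {x | deriv γ x ≠ 0} :=
    contDiffOn_aderivVec hγ hγ.contDiffOn
  exact (contDiffOn_aderivVec hγ hτ).inner ℝ (contDiff_rot.comp_contDiffOn hτ)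

theorem contDiffOn_kds {γ : ℝ → E2} (hγ : ContDiff ℝ (⊤ : ℕ∞) γ) (j : ℕ) :
    ContDiffOn ℝ (⊤ : ℕ∞) (kds γ j) {x | deriv γ x ≠ 0} := by
  induction j with
  | zero => exact contDiffOn_curv hγ
  | succ j ih => exact contDiffOn_aderiv hγ ih

theorem hasDerivAt_kds {γ : ℝ → E2} (hγ : ContDiff ℝ (⊤ : ℕ∞) γ) (j : ℕ) {x : ℝ}
    (hx : deriv γ x ≠ 0) : HasDerivAt (kds γ j) (kds γ (j + 1) x * ‖deriv γ x‖) x := by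
  have hd : DifferentiableAt ℝ (kds γ j) x :=
    ((contDiffOn_kds hγ j).contDiffAt ((isOpen_deriv_ne_zero hγ).mem_nhds hx)).differentiableAt
      (by simp)
  have heq : kds γ (j + 1) x * ‖deriv γ x‖ = deriv (kds γ j) x := by
    change (‖deriv γ x‖)⁻¹ * deriv (kds γ j) x * ‖deriv γ x‖ = _
    have := norm_ne_zero_iff.2 hx
    field_simp
  rw [heq]
  exact hd.hasDerivAt

theorem continuousOn_kds {γ : ℝ → E2} (hγ : ContDiff ℝ (⊤ : ℕ∞) γ)
    (hreg : ∀ x ∈ Icc (-1 : ℝ) 1, deriv γ x ≠ 0) (j : ℕ) :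
    ContinuousOn (kds γ j) (Icc (-1) 1) :=
  (contDiffOn_kds hγ j).continuousOn.mono hreg

theorem clen_eq_integral (γ : ℝ → E2) : clen γ = ∫ x in (-1 : ℝ)..1, ‖deriv γ x‖ := by
  simp [clen, cint]

/-- Poincaré-type inequality: if `k_{s^j}` vanishes somewhere on the curve then
`|k_{s^j}|² ≤ L ‖k_{s^{j+1}}‖₂²`. -/
theorem kds_sq_le {γ : ℝ → E2} (hγ : ContDiff ℝ (⊤ : ℕ∞) γ)
    (hreg : ∀ x ∈ Icc (-1 : ℝ) 1, deriv γ x ≠ 0) (j : ℕ) {c x : ℝ}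
    (hc : c ∈ Icc (-1 : ℝ) 1) (hkc : kds γ j c = 0) (hx : x ∈ Icc (-1 : ℝ) 1) :
    kds γ j x ^ 2 ≤ clen γ * knorm2 γ (j + 1) := by
  rw [clen_eq_integral]
  exact sq_le_integral_mul_integral_of_hasDerivAt (continuousOn_kds hγ hreg (j + 1))
    (hγ.continuous_deriv (by simp)).norm.continuousOn (fun _ _ => norm_nonneg _)
    (fun y hy => hasDerivAt_kds hγ j (hreg y hy)) hc hkc hx

theorem knorm2_le {γ : ℝ → E2} (hγ : ContDiff ℝ (⊤ : ℕ∞) γ)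
    (hreg : ∀ x ∈ Icc (-1 : ℝ) 1, deriv γ x ≠ 0) (j : ℕ) {M : ℝ}
    (hM : ∀ x ∈ Icc (-1 : ℝ) 1, kds γ j x ^ 2 ≤ M) : knorm2 γ j ≤ M * clen γ := by
  rw [clen_eq_integral]
  exact integral_mul_le_of_le (by norm_num) ((continuousOn_kds hγ hreg j).pow 2)
    (hγ.continuous_deriv (by simp)).norm.continuousOn (fun _ _ => norm_nonneg _) hM

theorem ksup_sq_le {γ : ℝ → E2} (j : ℕ) {M : ℝ}
    (hM : ∀ x ∈ Icc (-1 : ℝ) 1, kds γ j x ^ 2 ≤ M) : ksup γ j ^ 2 ≤ M := by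
  have hM0 : 0 ≤ M := (sq_nonneg _).trans (hM 0 (by simp))
  have h0 : 0 ≤ ksup γ j := by
    refine Real.sSup_nonneg ?_
    rintro _ ⟨x, -, rfl⟩
    exact abs_nonneg _
  have h1 : ksup γ j ≤ √M := by
    refine Real.sSup_le ?_ (Real.sqrt_nonneg M)
    rintro _ ⟨x, hx, rfl⟩
    exact Real.abs_le_sqrt (hM x hx)
  calc ksup γ j ^ 2 ≤ √M ^ 2 := pow_le_pow_left₀ h0 h1 2
    _ = M := Real.sq_sqrt hM0

/-- A curve of positive length and vanishing total curvature has a point of zero curvature. -/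
theorem exists_curv_eq_zero {γ : ℝ → E2} (hγ : ContDiff ℝ (⊤ : ℕ∞) γ)
    (hreg : ∀ x ∈ Icc (-1 : ℝ) 1, deriv γ x ≠ 0) (hL : 0 < clen γ) (hk : totalK γ = 0) :
    ∃ c ∈ Icc (-1 : ℝ) 1, curv γ c = 0 := by
  have hab : (-1 : ℝ) ≤ 1 := by norm_num
  obtain ⟨c, hc, h⟩ := exists_eq_const_mul_intervalIntegral_of_nonneg (μ := volume)
    (a := (-1 : ℝ)) (b := 1) (f := curv γ) (g := fun x => ‖deriv γ x‖)
    (by rw [uIcc_of_le hab]; exact continuousOn_kds hγ hreg 0)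
    ((hγ.continuous_deriv (by simp)).norm.intervalIntegrable _ _) (fun _ _ => norm_nonneg _)
  rw [uIcc_of_le hab] at hc
  rw [← clen_eq_integral] at h
  change totalK γ = _ at h
  rw [hk] at h
  exact ⟨c, hc, (mul_eq_zero.1 h.symm).resolve_right hL.ne'⟩

/-- **Exponential decay of `k` and `k_s`.**  Suppose that under the flow `ω(t) = 0` and
`|e| ≤ L(t) ≤ L₀` for all `t ∈ [0,T)` with `L₀ = L(0)`, and that
`‖k_{ss}(·,t)‖₂² ≤ K e^{-δt}` for constants `K, δ > 0`.  Then there is `C > 0`, depending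
only on `K`, `L₀` and `|e|`, with
`‖k‖₂² + ‖k_s‖₂² + ‖k‖_∞² + ‖k_s‖_∞² ≤ C e^{-δt}` for all `t ∈ [0,T)`; in particular the
curvature and its first arc length derivative decay pointwise exponentially to zero. -/
theorem curvature_exponential_decay (K L₀ e : ℝ) (hK : 0 < K) :
    ∃ C : ℝ, 0 < C ∧
      ∀ (δ : ℝ), 0 < δ →
      ∀ {T : ℝ≥0∞} (Φ : SixthFlow T), BC Φ e → clen (Φ.γ 0) = L₀ →
        (∀ t : ℝ, inTime T t →
          1 / (2 * π) * totalK (Φ.γ t) = 0 ∧ |e| ≤ clen (Φ.γ t) ∧ clen (Φ.γ t) ≤ L₀) →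
        (∀ t : ℝ, inTime T t → knorm2 (Φ.γ t) 2 ≤ K * Real.exp (-δ * t)) →
        ∀ t : ℝ, inTime T t →
          knorm2 (Φ.γ t) 0 + knorm2 (Φ.γ t) 1
              + (ksup (Φ.γ t) 0) ^ 2 + (ksup (Φ.γ t) 1) ^ 2
            ≤ C * Real.exp (-δ * t) ∧
          ∀ x ∈ Icc (-1:ℝ) 1,
            (curv (Φ.γ t) x) ^ 2 ≤ C * Real.exp (-δ * t) ∧
            (kds (Φ.γ t) 1 x) ^ 2 ≤ C * Real.exp (-δ * t) := by
  set A := |L₀| * K with hA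
  set N := A * |L₀| with hN
  set B := |L₀| * N with hB
  have hA0 : 0 ≤ A := by positivity
  have hN0 : 0 ≤ N := by positivity
  have hB0 : 0 ≤ B := by positivity
  have hBL : 0 ≤ B * |L₀| := by positivity
  refine ⟨B * |L₀| + N + B + A + 1, by positivity, ?_⟩
  intro δ _ T Φ bc _ hlen hdecay t ht
  obtain ⟨hω, heL, hLL⟩ := hlen t ht
  have hγ : ContDiff ℝ (⊤ : ℕ∞) (Φ.γ t) := Φ.smooth.comp (contDiff_const.prodMk contDiff_id)
  have hreg : ∀ x ∈ Icc (-1 : ℝ) 1, deriv (Φ.γ t) x ≠ 0 := fun x hx => Φ.regular ht hx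
  have hL : 0 < clen (Φ.γ t) := (abs_pos.2 bc.he).trans_le heL
  have hLabs : clen (Φ.γ t) ≤ |L₀| := hLL.trans (le_abs_self _)
  have htot : totalK (Φ.γ t) = 0 := (mul_eq_zero.1 hω).resolve_left (by positivity)
  obtain ⟨c, hc, hkc⟩ := exists_curv_eq_zero hγ hreg hL htot
  set E := Real.exp (-δ * t)
  have hE0 : 0 < E := Real.exp_pos _
  have hk1 : ∀ x ∈ Icc (-1 : ℝ) 1, kds (Φ.γ t) 1 x ^ 2 ≤ A * E := fun x hx =>
    calc kds (Φ.γ t) 1 x ^ 2 ≤ clen (Φ.γ t) * knorm2 (Φ.γ t) 2 :=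
          kds_sq_le hγ hreg 1 (by simp) (bc.noflux ht).1 hx
      _ ≤ clen (Φ.γ t) * (K * E) := mul_le_mul_of_nonneg_left (hdecay t ht) hL.le
      _ ≤ |L₀| * (K * E) := mul_le_mul_of_nonneg_right hLabs (by positivity)
      _ = A * E := by rw [hA]; ring
  have hn1 : knorm2 (Φ.γ t) 1 ≤ N * E :=
    calc knorm2 (Φ.γ t) 1 ≤ A * E * clen (Φ.γ t) := knorm2_le hγ hreg 1 hk1
      _ ≤ A * E * |L₀| := mul_le_mul_of_nonneg_left hLabs (by positivity)
      _ = N * E := by rw [hN]; ring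
  have hk0 : ∀ x ∈ Icc (-1 : ℝ) 1, kds (Φ.γ t) 0 x ^ 2 ≤ B * E := fun x hx =>
    calc kds (Φ.γ t) 0 x ^ 2 ≤ clen (Φ.γ t) * knorm2 (Φ.γ t) 1 :=
          kds_sq_le hγ hreg 0 hc hkc hx
      _ ≤ clen (Φ.γ t) * (N * E) := mul_le_mul_of_nonneg_left hn1 hL.le
      _ ≤ |L₀| * (N * E) := mul_le_mul_of_nonneg_right hLabs (by positivity)
      _ = B * E := by rw [hB]; ring
  have hn0 : knorm2 (Φ.γ t) 0 ≤ B * |L₀| * E :=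
    calc knorm2 (Φ.γ t) 0 ≤ B * E * clen (Φ.γ t) := knorm2_le hγ hreg 0 hk0
      _ ≤ B * E * |L₀| := mul_le_mul_of_nonneg_left hLabs (by positivity)
      _ = B * |L₀| * E := by ring
  have hs0 := ksup_sq_le 0 hk0
  have hs1 := ksup_sq_le 1 hk1
  refine ⟨by linarith, fun x hx => ⟨(hk0 x hx).trans ?_, (hk1 x hx).trans ?_⟩⟩
  · exact mul_le_mul_of_nonneg_right (by linarith) hE0.le
  · exact mul_le_mul_of_nonneg_right (by linarith) hE0.le
end
end
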